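/- Let F satisfy (SH) and (H1) and let φ:ℝⁿ→ℝ be locally Lipschitz. Let x̄:[t₀,T]→ℝⁿ be an optimal solution of the Mayer problem P(t₀,x₀) and let p̄:[t₀,T]→ℝⁿ be any absolutely continuous arc satisfying −p̄'(t) ∈ ∂ₓ⁻H(x̄(t),p̄(t)) and x̄'(t) ∈ ∂ₚH(x̄(t),p̄(t)) for a.e. t ∈ [t₀,T], together with the transversality condition −p̄(T) ∈ ∂⁺φ(x̄(T)). Then the full sensitivity relation (H(x̄(t),p̄(t)), −p̄(t)) ∈ ∂⁺V(t, x̄(t)) holds for all t ∈ (t₀,T). -/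

import Mathlib

open MeasureTheory Filter Metric Set Topology
open scoped RealInnerProductSpace ENNReal NNReal Pointwise

noncomputable section

variable {E : Type*} [NormedAddCommGroup E] [InnerProductSpace ℝ E] [CompleteSpace E]

/-- The Hamiltonian `H(x,p) = sup_{v ∈ F x} ⟪v,p⟫` associated with `F`. -/
def Ham (F : E → Set E) (x p : E) : ℝ :=
  sSup ((fun v => ⟪v, p⟫) '' F x)

/-- Standing hypotheses (SH): nonempty convex compact values, local Lipschitz continuity
with respect to the Hausdorff metric, and sublinear growth. -/
def StandingHyp (F : E → Set E) : Prop :=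
  (∀ x, (F x).Nonempty ∧ Convex ℝ (F x) ∧ IsCompact (F x)) ∧
  (∀ x : E, ∃ ε > (0:ℝ), ∃ c : ℝ, 0 ≤ c ∧ ∀ y ∈ ball x ε, ∀ z ∈ ball x ε,
    EMetric.hausdorffEdist (F y) (F z) ≤ ENNReal.ofReal (c * dist y z)) ∧
  (∃ r > (0:ℝ), ∀ x : E, ∀ v ∈ F x, ‖v‖ ≤ r * (1 + ‖x‖))

/-- `f` is semiconvex on `K` with constant `c`. -/
def SemiconvexWith (f : E → ℝ) (K : Set E) (c : ℝ) : Prop :=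
  ∀ x h : E, x + h ∈ K → x - h ∈ K → -(c * ‖h‖ ^ 2) ≤ f (x + h) + f (x - h) - 2 * f x

/-- `f` is semiconcave on `K` with constant `c`. -/
def SemiconcaveWith (f : E → ℝ) (K : Set E) (c : ℝ) : Prop :=
  ∀ x h : E, x + h ∈ K → x - h ∈ K → f (x + h) + f (x - h) - 2 * f x ≤ c * ‖h‖ ^ 2

def LocSemiconcave (f : E → ℝ) : Prop :=
  ∀ x : E, ∃ ε > (0:ℝ), ∃ c : ℝ, SemiconcaveWith f (ball x ε) c

def LocSemiconvex (f : E → ℝ) : Prop :=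
  ∀ x : E, ∃ ε > (0:ℝ), ∃ c : ℝ, SemiconvexWith f (ball x ε) c

open scoped Classical in
/-- The gradient `∇ₚH(x,p)` of `H(x,·)` at `p` (junk value `0` if it does not exist). -/
def gradpH (F : E → Set E) (x p : E) : E :=
  if h : ∃ g, HasGradientAt (fun q => Ham F x q) g p then h.choose else 0

/-- Hypothesis (H1): semiconvexity of `H(·,p)` with constant `c‖p‖` on compact convex sets,
existence of `∇ₚH(x,p)` for `p ≠ 0`, and local Lipschitz continuity of `x ↦ ∇ₚH(x,p)`,
uniformly for `p` in compact subsets of `ℝⁿ ∖ {0}`. -/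
def HypH1 (F : E → Set E) : Prop :=
  (∀ K : Set E, K.Nonempty → Convex ℝ K → IsCompact K →
    ∃ c : ℝ, 0 ≤ c ∧ ∀ p : E, SemiconvexWith (fun x => Ham F x p) K (c * ‖p‖)) ∧
  (∀ x p : E, p ≠ 0 → HasGradientAt (fun q => Ham F x q) (gradpH F x p) p) ∧
  (∀ K : Set E, K.Nonempty → Convex ℝ K → IsCompact K →
    ∀ P : Set E, IsCompact P → (0:E) ∉ P →
      ∃ L : ℝ≥0, ∀ p ∈ P, LipschitzOnWith L (fun x => gradpH F x p) K)

/-- Fréchet subdifferential `∂⁻f(x)`. -/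
def FSub (f : E → ℝ) (x : E) : Set E :=
  {p | ∀ ε > (0:ℝ), ∀ᶠ y in 𝓝 x, -(ε * ‖y - x‖) ≤ f y - f x - ⟪p, y - x⟫}

/-- Fréchet superdifferential `∂⁺f(x)`. -/
def FSuper (f : E → ℝ) (x : E) : Set E :=
  {p | ∀ ε > (0:ℝ), ∀ᶠ y in 𝓝 x, f y - f x - ⟪p, y - x⟫ ≤ ε * ‖y - x‖}

/-- Proximal superdifferential `∂^{+,pr}f(x)`. -/
def ProxSuper (f : E → ℝ) (x : E) : Set E :=
  {p | ∃ c : ℝ, 0 ≤ c ∧ ∃ ρ > (0:ℝ), ∀ y ∈ closedBall x ρ,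
    f y - f x - ⟪p, y - x⟫ ≤ c * ‖y - x‖ ^ 2}

/-- Clarke's generalized gradient of `f` at `x`:
`ζ ∈ ∂f(x)` iff `⟪ζ,v⟫ ≤ limsup_{y→x, h→0⁺} (f(y+hv)-f(y))/h` for all `v`. -/
def ClarkeGrad (f : E → ℝ) (x : E) : Set E :=
  {ζ | ∀ v : E, ∀ ε > (0:ℝ),
    ∃ᶠ q : E × ℝ in (𝓝 x) ×ˢ (𝓝[>] (0:ℝ)),
      ⟪ζ, v⟫ - ε ≤ (f (q.1 + q.2 • v) - f q.1) / q.2}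

/-- `x` is absolutely continuous on `[t0,T]` with (a.e.) derivative `x'`. -/
def ACArc (t0 T : ℝ) (x x' : ℝ → E) : Prop :=
  IntervalIntegrable x' volume t0 T ∧
  (∀ s ∈ Icc t0 T, x s = x t0 + ∫ r in t0..s, x' r) ∧
  (∀ᵐ s ∂volume, s ∈ Icc t0 T → HasDerivAt x (x' s) s)

/-- `x` is a trajectory of the differential inclusion `x' ∈ F(x)` on `[t0,T]`. -/
def IsTraj (F : E → Set E) (t0 T : ℝ) (x x' : ℝ → E) : Prop :=
  ACArc t0 T x x' ∧ ∀ᵐ s ∂volume, s ∈ Icc t0 T → x' s ∈ F (x s)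

/-- `x` is an optimal trajectory for the Mayer problem `P(t0,x0)`. -/
def IsOptimal (F : E → Set E) (φ : E → ℝ) (t0 T : ℝ) (x0 : E) (x x' : ℝ → E) : Prop :=
  IsTraj F t0 T x x' ∧ x t0 = x0 ∧
  ∀ y y' : ℝ → E, IsTraj F t0 T y y' → y t0 = x0 → φ (x T) ≤ φ (y T)

/-- The value function of the Mayer problem. -/
def valueFn (F : E → Set E) (φ : E → ℝ) (T t : ℝ) (x : E) : ℝ :=
  sInf {r | ∃ y y' : ℝ → E, IsTraj F t T y y' ∧ y t = x ∧ r = φ (y T)}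

/-- Fréchet superdifferential of `W` in the pair `(t,x)`. -/
def FSuperPair (W : ℝ → E → ℝ) (t : ℝ) (x : E) : Set (ℝ × E) :=
  {q | ∀ ε > (0:ℝ), ∀ᶠ sy : ℝ × E in 𝓝 (t, x),
    W sy.1 sy.2 - W t x - q.1 * (sy.1 - t) - ⟪q.2, sy.2 - x⟫ ≤
      ε * ‖((sy.1 - t, sy.2 - x) : ℝ × E)‖}

/-- Fréchet subdifferential of `W` in the pair `(t,x)`. -/
def FSubPair (W : ℝ → E → ℝ) (t : ℝ) (x : E) : Set (ℝ × E) :=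
  {q | ∀ ε > (0:ℝ), ∀ᶠ sy : ℝ × E in 𝓝 (t, x),
    -(ε * ‖((sy.1 - t, sy.2 - x) : ℝ × E)‖) ≤
      W sy.1 sy.2 - W t x - q.1 * (sy.1 - t) - ⟪q.2, sy.2 - x⟫}

/-- Proximal superdifferential of `W` in the pair `(t,x)`. -/
def ProxSuperPair (W : ℝ → E → ℝ) (t : ℝ) (x : E) : Set (ℝ × E) :=
  {q | ∃ c : ℝ, 0 ≤ c ∧ ∃ ρ > (0:ℝ), ∀ s : ℝ, ∀ y : E,
    dist ((s, y) : ℝ × E) ((t, x) : ℝ × E) ≤ ρ →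
      W s y - W t x - q.1 * (s - t) - ⟪q.2, y - x⟫ ≤ c * ‖((s - t, y - x) : ℝ × E)‖ ^ 2}

/-- `V` is differentiable at `(t,x)` with (pair) gradient `q = (∂ₜV, ∇ₓV)`. -/
def HasGradPair (W : ℝ → E → ℝ) (t : ℝ) (x : E) (q : ℝ × E) : Prop :=
  HasFDerivAt (fun sy : ℝ × E => W sy.1 sy.2)
    (q.1 • ContinuousLinearMap.fst ℝ ℝ E +
      (innerSL ℝ q.2).comp (ContinuousLinearMap.snd ℝ ℝ E)) (t, x)

/-- The reachable (limiting) gradient `∂*W(t,x)`. -/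
def ReachGradPair (W : ℝ → E → ℝ) (t : ℝ) (x : E) : Set (ℝ × E) :=
  {q | ∃ u g : ℕ → ℝ × E,
    (∀ i, HasGradPair W (u i).1 (u i).2 (g i)) ∧
    Tendsto u atTop (𝓝 (t, x)) ∧ Tendsto g atTop (𝓝 q)}

/-- Normal cone (of convex analysis) to `A` at `z`. -/
def normalConeAt (A : Set E) (z : E) : Set E :=
  {p | ∀ v ∈ A, ⟪p, v - z⟫ ≤ 0}

/-- `A` is `R`-convex. -/
def RConvex (A : Set E) (R : ℝ) : Prop :=
  ∀ z ∈ frontier A, ∀ y ∈ frontier A, ∀ n ∈ normalConeAt A z, ∀ m ∈ normalConeAt A y,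
    ‖n‖ = 1 → ‖m‖ = 1 → ‖z - y‖ ≤ R * ‖n - m‖

/-- `F` is locally strongly convex. -/
def LocStronglyConvex (F : E → Set E) : Prop :=
  ∀ K : Set E, IsCompact K → ∃ R > (0:ℝ), ∀ x ∈ K, RConvex (F x) R

/-- `ℝⁿ` as a Euclidean space. -/
abbrev Euc (n : ℕ) : Type := EuclideanSpace ℝ (Fin n)

set_option linter.unusedSectionVars false

section IntegralLemmas

variable {G : Type*} [NormedAddCommGroup G]

theorem IntervalIntegrable.mono_Icc {a b c d : ℝ} {u : ℝ → G}
    (hu : IntervalIntegrable u volume a b) (hac : a ≤ c) (hcd : c ≤ d) (hdb : d ≤ b) :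
    IntervalIntegrable u volume c d :=
  hu.mono_set (by
    rw [uIcc_of_le hcd, uIcc_of_le (hac.trans (hcd.trans hdb))]
    exact Icc_subset_Icc hac hdb)

variable [NormedSpace ℝ G]

theorem continuousOn_primitive_Icc {a b : ℝ} (hab : a ≤ b) {u : ℝ → G}
    (hu : IntervalIntegrable u volume a b) (y0 : G) :
    ContinuousOn (fun s => y0 + ∫ r in a..s, u r) (Icc a b) := by
  have := intervalIntegral.continuousOn_primitive_interval' hu (left_mem_uIcc)
  rw [uIcc_of_le hab] at this
  exact continuousOn_const.add this

theorem norm_integral_diff_le {a s A L : ℝ} (has : a ≤ s) (k : ℕ) {u v : ℝ → G}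
    (h : ∀ᵐ r, r ∈ Icc a s → ‖u r - v r‖ ≤ A * ((L * (r - a)) ^ k / k.factorial)) :
    L * ‖∫ r in a..s, (u r - v r)‖ ≤ A * ((L * (s - a)) ^ (k + 1) / (k + 1).factorial) ∨ L < 0 := by
  rcases lt_or_ge L 0 with hL | hL
  · exact Or.inr hL
  left
  have h1 : ‖∫ r in a..s, (u r - v r)‖ ≤
      ∫ r in a..s, A * ((L * (r - a)) ^ k / k.factorial) := by
    apply intervalIntegral.norm_integral_le_of_norm_le has
    · filter_upwards [h] with r hr hrI
      exact hr (Ioc_subset_Icc_self hrI)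
    · apply Continuous.intervalIntegrable
      fun_prop
  have h2 : ∫ r in a..s, A * ((L * (r - a)) ^ k / k.factorial) =
      A * (L ^ k * (s - a) ^ (k + 1) / (k + 1).factorial) := by
    have h3 : ∀ r : ℝ, A * ((L * (r - a)) ^ k / k.factorial) =
        (A * L ^ k / k.factorial) * (r - a) ^ k := fun r => by rw [mul_pow]; ring
    simp_rw [h3]
    rw [intervalIntegral.integral_const_mul,
      intervalIntegral.integral_comp_sub_right (fun r => r ^ k) a, integral_pow,
      Nat.factorial_succ]
    push_cast
    have : (k.factorial : ℝ) ≠ 0 := by positivity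
    field_simp
    simp
  rw [h2] at h1
  calc L * ‖∫ r in a..s, (u r - v r)‖
      ≤ L * (A * (L ^ k * (s - a) ^ (k + 1) / (k + 1).factorial)) := by gcongr
    _ = _ := by rw [mul_pow]; ring

end IntegralLemmas

section Filippov

/-- Primitives of an interval integrable function are absolutely continuous arcs. -/
theorem acArc_primitive {a b : ℝ} (hab : a ≤ b) {u : ℝ → E}
    (hu : IntervalIntegrable u volume a b) (y0 : E) :
    ACArc a b (fun s => y0 + ∫ r in a..s, u r) u := by
  refine ⟨hu, fun s _ => by simp, ?_⟩
  filter_upwards [hu.ae_hasDerivAt_integral] with s hs hsI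
  exact (hs (by rwa [uIcc_of_le hab]) a (by simp)).const_add y0

/-- The successive approximations `uₖ₊₁(s) = S(s, y₀ + ∫ₐˢ uₖ, uₖ(s))` in the proof of Filippov's
theorem. -/
def filippovSeq (S : ℝ → E → E → E) (a : ℝ) (y0 : E) (u0 : ℝ → E) : ℕ → ℝ → E
  | 0 => u0
  | k + 1 => fun s => S s (y0 + ∫ r in a..s, filippovSeq S a y0 u0 k r) (filippovSeq S a y0 u0 k s)

theorem filippovSeq_spec {S : ℝ → E → E → E}
    (hS : Continuous fun q : ℝ × E × E => S q.1 q.2.1 q.2.2) {Γ : ℝ → E → Set E}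
    (hmem : ∀ s x v, S s x v ∈ Γ s x) {L a b : ℝ} (hL : 0 ≤ L) (hab : a ≤ b)
    (hLip : ∀ s x z v, v ∈ Γ s z → ‖S s x v - v‖ ≤ L * ‖x - z‖) {x x' : ℝ → E}
    (hx' : IntervalIntegrable x' volume a b)
    (hx : ∀ s ∈ Icc a b, x s = x a + ∫ r in a..s, x' r)
    (hxΓ : ∀ᵐ s, s ∈ Icc a b → x' s ∈ Γ s (x s)) (y0 : E) (k : ℕ) :
    IntervalIntegrable (filippovSeq S a y0 x' k) volume a b ∧
      ∀ s ∈ Icc a b, x' s ∈ Γ s (x s) →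
        ‖filippovSeq S a y0 x' (k + 1) s - filippovSeq S a y0 x' k s‖ ≤
          L * ‖y0 - x a‖ * ((L * (s - a)) ^ k / k.factorial) := by
  induction k with
  | zero =>
    refine ⟨hx', fun s hs hsΓ => ?_⟩
    have := hLip s (y0 + ∫ r in a..s, x' r) (x s) (x' s) hsΓ
    rw [hx s hs, add_sub_add_right_eq_sub] at this
    simpa [filippovSeq] using this
  | succ k ih =>
    obtain ⟨hI, hdiff⟩ := ih
    set u := filippovSeq S a y0 x' k with hu
    have hI' : IntervalIntegrable (filippovSeq S a y0 x' (k + 1)) volume a b := by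
      have hbd : IntervalIntegrable (fun s => ‖u s‖ +
          L * ‖y0 - x a‖ * ((L * (s - a)) ^ k / k.factorial)) volume a b := by
        apply hI.norm.add
        apply Continuous.intervalIntegrable
        fun_prop
      refine hbd.mono_fun ?_ ?_
      · rw [uIoc_of_le hab]
        have h1 : AEStronglyMeasurable (fun s => y0 + ∫ r in a..s, u r)
            (volume.restrict (Ioc a b)) :=
          ((continuousOn_primitive_Icc hab hI y0).mono
            Ioc_subset_Icc_self).aestronglyMeasurable measurableSet_Ioc
        have h2 : AEStronglyMeasurable u (volume.restrict (Ioc a b)) := hI.1.1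
        exact hS.comp_aestronglyMeasurable
          (measurable_id.aestronglyMeasurable.prodMk (h1.prodMk h2))
      · rw [uIoc_of_le hab]
        filter_upwards [ae_restrict_of_ae hxΓ, ae_restrict_mem measurableSet_Ioc] with s h1 h2
        have h2' := Ioc_subset_Icc_self h2
        have h3 := hdiff s h2' (h1 h2')
        have h4 := norm_le_norm_add_norm_sub' (filippovSeq S a y0 x' (k + 1) s) (u s)
        exact (h4.trans (by gcongr)).trans (le_abs_self _)
    refine ⟨hI', fun s hs hsΓ => ?_⟩
    have h1 := hLip s (y0 + ∫ r in a..s, filippovSeq S a y0 x' (k + 1) r)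
      (y0 + ∫ r in a..s, u r) (filippovSeq S a y0 x' (k + 1) s) (hmem _ _ _)
    rw [add_sub_add_left_eq_sub, ← intervalIntegral.integral_sub
      (hI'.mono_Icc le_rfl hs.1 hs.2) (hI.mono_Icc le_rfl hs.1 hs.2)] at h1
    refine h1.trans ((norm_integral_diff_le (L := L) hs.1 k ?_).resolve_right hL.not_gt)
    filter_upwards [hxΓ] with r hr hrI
    have hr' : r ∈ Icc a b := ⟨hrI.1, hrI.2.trans hs.2⟩
    exact hdiff r hr' (hr hr')

/-- **Filippov's theorem**: a set-valued map with a continuous Lipschitz-type selection `S` admits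
a trajectory starting at `y0` which stays close to a given trajectory `x`. -/
theorem exists_traj_near {S : ℝ → E → E → E}
    (hS : Continuous fun q : ℝ × E × E => S q.1 q.2.1 q.2.2) {Γ : ℝ → E → Set E}
    (hΓ : ∀ s, IsClosed {q : E × E | q.2 ∈ Γ s q.1})
    (hmem : ∀ s x v, S s x v ∈ Γ s x) {L a b : ℝ} (hL : 0 ≤ L) (hab : a ≤ b)
    (hLip : ∀ s x z v, v ∈ Γ s z → ‖S s x v - v‖ ≤ L * ‖x - z‖) {x x' : ℝ → E}
    (hx' : IntervalIntegrable x' volume a b)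
    (hx : ∀ s ∈ Icc a b, x s = x a + ∫ r in a..s, x' r)
    (hxΓ : ∀ᵐ s, s ∈ Icc a b → x' s ∈ Γ s (x s)) (y0 : E) :
    ∃ y y' : ℝ → E, ACArc a b y y' ∧ y a = y0 ∧ (∀ᵐ s, s ∈ Icc a b → y' s ∈ Γ s (y s)) ∧
      ∀ s ∈ Icc a b,
        ‖y s - x s‖ ≤ (1 + L * Real.exp (L * (b - a)) * (b - a)) * ‖y0 - x a‖ := by
  have hspec := filippovSeq_spec hS hmem hL hab hLip hx' hx hxΓ y0
  set u := filippovSeq S a y0 x' with hu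
  set D := L * ‖y0 - x a‖ * Real.exp (L * (b - a)) with hD
  have hsum : ∀ s ∈ Icc a b, x' s ∈ Γ s (x s) →
      Summable fun k => u (k + 1) s - u k s := fun s hs hsΓ =>
    Summable.of_norm_bounded ((Real.summable_pow_div_factorial _).mul_left _)
      (fun k => (hspec k).2 s hs hsΓ)
  have hubd : ∀ s ∈ Icc a b, x' s ∈ Γ s (x s) → ∀ k, ‖u k s - x' s‖ ≤ D := by
    intro s hs hsΓ k
    have h1 : u k s - x' s = ∑ i ∈ Finset.range k, (u (i + 1) s - u i s) := by
      rw [Finset.sum_range_sub (fun i => u i s)]; rfl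
    have h0 : 0 ≤ L * (s - a) := mul_nonneg hL (sub_nonneg.2 hs.1)
    calc ‖u k s - x' s‖ ≤ ∑ i ∈ Finset.range k, ‖u (i + 1) s - u i s‖ := by
          rw [h1]; exact norm_sum_le _ _
      _ ≤ ∑ i ∈ Finset.range k, L * ‖y0 - x a‖ * ((L * (s - a)) ^ i / i.factorial) :=
          Finset.sum_le_sum fun i _ => (hspec i).2 s hs hsΓ
      _ = L * ‖y0 - x a‖ * ∑ i ∈ Finset.range k, (L * (s - a)) ^ i / i.factorial := by
          rw [Finset.mul_sum]
      _ ≤ L * ‖y0 - x a‖ * Real.exp (L * (s - a)) := by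
          gcongr
          exact Real.sum_le_exp_of_nonneg h0 k
      _ ≤ D := by
          rw [hD]
          gcongr
          exact hs.2
  set y' : ℝ → E := fun s => x' s + ∑' k, (u (k + 1) s - u k s) with hy'
  have hlim : ∀ s ∈ Icc a b, x' s ∈ Γ s (x s) → Tendsto (fun k => u k s) atTop (𝓝 (y' s)) := by
    intro s hs hsΓ
    have h1 := ((hsum s hs hsΓ).hasSum.tendsto_sum_nat).const_add (x' s)
    refine h1.congr fun k => ?_
    rw [Finset.sum_range_sub (fun i => u i s)]
    simp [hu, filippovSeq]
  have hy'bd : ∀ s ∈ Icc a b, x' s ∈ Γ s (x s) → ‖y' s - x' s‖ ≤ D := fun s hs hsΓ =>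
    le_of_tendsto ((hlim s hs hsΓ).sub_const (x' s)).norm
      (Eventually.of_forall fun k => hubd s hs hsΓ k)
  have hbdint : IntervalIntegrable (fun s => ‖x' s‖ + D) volume a b :=
    hx'.norm.add intervalIntegrable_const
  have hgood : ∀ᵐ s ∂(volume.restrict (Ioc a b)), s ∈ Icc a b ∧ x' s ∈ Γ s (x s) := by
    filter_upwards [ae_restrict_of_ae hxΓ, ae_restrict_mem measurableSet_Ioc] with s h1 h2
    exact ⟨Ioc_subset_Icc_self h2, h1 (Ioc_subset_Icc_self h2)⟩
  have hy'int : IntervalIntegrable y' volume a b := by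
    refine hbdint.mono_fun ?_ ?_
    · rw [uIoc_of_le hab]
      refine aestronglyMeasurable_of_tendsto_ae atTop (fun k => (hspec k).1.1.1) ?_
      filter_upwards [hgood] with s hs
      exact hlim s hs.1 hs.2
    · rw [uIoc_of_le hab]
      filter_upwards [hgood] with s hs
      have h4 := norm_le_norm_add_norm_sub' (y' s) (x' s)
      exact (h4.trans (by gcongr; exact hy'bd s hs.1 hs.2)).trans (le_abs_self _)
  have hYlim : ∀ s ∈ Icc a b, Tendsto (fun k => y0 + ∫ r in a..s, u k r) atTop
      (𝓝 (y0 + ∫ r in a..s, y' r)) := by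
    intro s hs
    refine Tendsto.const_add _ ?_
    refine intervalIntegral.tendsto_integral_filter_of_dominated_convergence
      (fun s => ‖x' s‖ + D) ?_ ?_ (hbdint.mono_Icc le_rfl hs.1 hs.2) ?_
    · refine Eventually.of_forall fun k => ?_
      rw [uIoc_of_le hs.1]
      exact ((hspec k).1.mono_Icc le_rfl hs.1 hs.2).1.1
    · refine Eventually.of_forall fun k => ?_
      filter_upwards [hxΓ] with r hr hrI
      rw [uIoc_of_le hs.1] at hrI
      have hr' : r ∈ Icc a b := ⟨hrI.1.le, hrI.2.trans hs.2⟩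
      have h4 := norm_le_norm_add_norm_sub' (u k r) (x' r)
      exact h4.trans (by gcongr; exact hubd r hr' (hr hr') k)
    · filter_upwards [hxΓ] with r hr hrI
      rw [uIoc_of_le hs.1] at hrI
      have hr' : r ∈ Icc a b := ⟨hrI.1.le, hrI.2.trans hs.2⟩
      exact hlim r hr' (hr hr')
  refine ⟨fun s => y0 + ∫ r in a..s, y' r, y', acArc_primitive hab hy'int y0, by simp, ?_, ?_⟩
  · filter_upwards [hxΓ] with s hs hsI
    have h1 := (hYlim s hsI).prodMk_nhds ((tendsto_add_atTop_iff_nat 1).2 (hlim s hsI (hs hsI)))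
    exact (hΓ s).mem_of_tendsto h1 (Eventually.of_forall fun k => hmem _ _ _)
  · intro s hs
    have h1 : (y0 + ∫ r in a..s, y' r) - x s = (y0 - x a) + ∫ r in a..s, (y' r - x' r) := by
      rw [hx s hs, intervalIntegral.integral_sub (hy'int.mono_Icc le_rfl hs.1 hs.2)
        (hx'.mono_Icc le_rfl hs.1 hs.2)]
      abel
    have h2 : ‖∫ r in a..s, (y' r - x' r)‖ ≤ D * |s - a| := by
      apply intervalIntegral.norm_integral_le_of_norm_le_const_ae
      filter_upwards [hxΓ] with r hr hrI
      rw [uIoc_of_le hs.1] at hrI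
      have hr' : r ∈ Icc a b := ⟨hrI.1.le, hrI.2.trans hs.2⟩
      exact hy'bd r hr' (hr hr')
    have hD0 : 0 ≤ D := by positivity
    rw [abs_of_nonneg (sub_nonneg.2 hs.1)] at h2
    change ‖(y0 + ∫ r in a..s, y' r) - x s‖ ≤ _
    rw [h1]
    calc _ ≤ ‖y0 - x a‖ + D * (s - a) := (norm_add_le _ _).trans (by gcongr)
      _ ≤ ‖y0 - x a‖ + D * (b - a) := by
          gcongr
          exact hs.2
      _ = _ := by rw [hD]; ring

end Filippov

section SetValued

theorem inner_le_zero_of_norm_le_infDist {A : Set E} (hA : Convex ℝ A) {v w z : E} (hw : w ∈ A)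
    (h : ‖v - w‖ ≤ infDist v A) (hz : z ∈ A) : ⟪v - w, z - w⟫ ≤ 0 := by
  have hne : A.Nonempty := ⟨w, hw⟩
  have h1 : ‖v - w‖ = ⨅ u : A, ‖v - u‖ := by
    have h2 : infDist v A = ⨅ u : A, ‖v - u‖ := by
      rw [infDist_eq_iInf]; simp_rw [dist_eq_norm]
    rw [← h2]
    exact le_antisymm h (by rw [← dist_eq_norm]; exact infDist_le_dist_of_mem hw)
  exact (norm_eq_iInf_iff_real_inner_le_zero hA hw).1 h1 z hz

theorem norm_sub_le_of_norm_le_infDist {A : Set E} (hA : Convex ℝ A) {v w v' w' : E} (hw : w ∈ A)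
    (h : ‖v - w‖ ≤ infDist v A) (hw' : w' ∈ A) (h' : ‖v' - w'‖ ≤ infDist v' A) :
    ‖w - w'‖ ≤ ‖v - v'‖ := by
  have h1 := inner_le_zero_of_norm_le_infDist hA hw h hw'
  have h2 := inner_le_zero_of_norm_le_infDist hA hw' h' hw
  have h3 : ‖w - w'‖ * ‖w - w'‖ = ⟪v - v', w - w'⟫ + ⟪v - w, w' - w⟫ + ⟪v' - w', w - w'⟫ := by
    rw [← real_inner_self_eq_norm_mul_norm]
    simp only [inner_sub_left, inner_sub_right]
    ring
  have h4 := real_inner_le_norm (v - v') (w - w')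
  by_contra! hlt
  nlinarith [norm_nonneg (v - v')]

/-- A closed ball is a 1-Lipschitz retract of the space. -/
theorem exists_retraction_closedBall [ProperSpace E] {R : ℝ} (hR : 0 ≤ R) :
    ∃ P : E → E, (∀ x, P x ∈ closedBall (0 : E) R) ∧ (∀ x y, ‖P x - P y‖ ≤ ‖x - y‖) ∧
      ∀ x ∈ closedBall (0 : E) R, P x = x := by
  have hne : (closedBall (0 : E) R).Nonempty := ⟨0, by simpa using hR⟩
  choose P hP hP' using fun x =>
    (isCompact_closedBall (0 : E) R).exists_infDist_eq_dist hne x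
  have hP'' : ∀ x, ‖x - P x‖ ≤ infDist x (closedBall (0 : E) R) := fun x => by
    rw [hP' x, dist_eq_norm]
  refine ⟨P, hP, fun x y => norm_sub_le_of_norm_le_infDist (convex_closedBall _ _) (hP x) (hP'' x)
    (hP y) (hP'' y), fun x hx => ?_⟩
  have := hP'' x
  rw [infDist_zero_of_mem hx] at this
  exact (sub_eq_zero.1 (norm_le_zero_iff.1 this)).symm

/-- A bounded function with closed graph is continuous. -/
theorem continuous_of_isClosed_graph_of_norm_le [ProperSpace E] {X : Type*} [TopologicalSpace X]
    {f : X → E} {M : ℝ} (hM : ∀ x, ‖f x‖ ≤ M) {g : Set (X × E)} (hg : IsClosed g)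
    (hfg : ∀ x v, (x, v) ∈ g ↔ v = f x) : Continuous f := by
  rw [continuous_iff_continuousAt]
  intro x
  refine (isCompact_closedBall (0 : E) M).tendsto_nhds_of_unique_mapClusterPt
    (Eventually.of_forall fun y => by simpa using hM y) fun y _ hy => ?_
  rw [← hfg]
  rw [← hg.closure_eq, mem_closure_iff_nhds]
  intro t ht
  obtain ⟨u, hu, v, hv, huv⟩ := mem_nhds_prod_iff.1 ht
  have h1 := mapClusterPt_iff_frequently.1 hy v hv
  obtain ⟨z, hz, hz'⟩ := (h1.and_eventually hu).exists
  exact ⟨(z, f z), huv ⟨hz', hz⟩, (hfg _ _).2 rfl⟩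

/-- Set-valued maps with nonempty, convex, compact values, globally Lipschitz with constant `L`
and globally bounded by `M`. -/
structure LipBddMap (F : E → Set E) (L M : ℝ) : Prop where
  nonempty : ∀ x, (F x).Nonempty
  convex : ∀ x, Convex ℝ (F x)
  isCompact : ∀ x, IsCompact (F x)
  exists_near : ∀ x y, ∀ v ∈ F x, ∃ w ∈ F y, ‖v - w‖ ≤ L * ‖x - y‖
  norm_le : ∀ x, ∀ v ∈ F x, ‖v‖ ≤ M
  const_nonneg : 0 ≤ L

theorem inner_le_ham {F : E → Set E} {x : E} (hF : IsCompact (F x)) {v : E} (hv : v ∈ F x) (p : E) :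
    ⟪v, p⟫ ≤ Ham F x p :=
  le_csSup (hF.image (by fun_prop)).bddAbove ⟨v, hv, rfl⟩

theorem exists_inner_eq_ham {F : E → Set E} {x : E} (hF : IsCompact (F x)) (hne : (F x).Nonempty)
    (p : E) : ∃ v ∈ F x, ⟪v, p⟫ = Ham F x p :=
  (hF.image (f := fun v : E => ⟪v, p⟫) (by fun_prop)).sSup_mem (hne.image _)

theorem ham_zero {F : E → Set E} {x : E} (hne : (F x).Nonempty) : Ham F x 0 = 0 := by
  simp [Ham, hne.image_const]

theorem ham_sub_le {F : E → Set E} {x y : E} (hx : IsCompact (F x)) (hxn : (F x).Nonempty)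
    (hy : IsCompact (F y)) {d M : ℝ} (hd : ∀ v ∈ F x, ∃ w ∈ F y, ‖v - w‖ ≤ d)
    (hM : ∀ v ∈ F y, ‖v‖ ≤ M) (p q : E) :
    Ham F x p - Ham F y q ≤ M * ‖p - q‖ + d * ‖p‖ := by
  obtain ⟨v, hv, hvp⟩ := exists_inner_eq_ham hx hxn p
  obtain ⟨w, hw, hvw⟩ := hd v hv
  have h1 := inner_le_ham hy hw q
  have h2 : ⟪v, p⟫ = ⟪w, q⟫ + ⟪w, p - q⟫ + ⟪v - w, p⟫ := by
    simp only [inner_sub_left, inner_sub_right]; ring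
  have h3 : ⟪w, p - q⟫ ≤ M * ‖p - q‖ := (real_inner_le_norm _ _).trans (by gcongr; exact hM w hw)
  have h4 : ⟪v - w, p⟫ ≤ d * ‖p‖ := (real_inner_le_norm _ _).trans (by gcongr)
  linarith

/-- The set of elements of `F x` maximizing the Hamiltonian in direction `p`. -/
def maxFace (F : E → Set E) (p x : E) : Set E := {v | v ∈ F x ∧ ⟪v, p⟫ = Ham F x p}

namespace LipBddMap

variable {F : E → Set E} {L M : ℝ}

theorem continuous_ham (hF : LipBddMap F L M) : Continuous fun q : E × E => Ham F q.1 q.2 := by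
  rw [continuous_iff_continuousAt]
  rintro ⟨x, p⟩
  have key : ∀ q : E × E, |Ham F q.1 q.2 - Ham F x p| ≤
      M * ‖q.2 - p‖ + L * ‖q.1 - x‖ * (‖q.2‖ + ‖p‖) := by
    intro q
    have hL := hF.const_nonneg
    have h1 := ham_sub_le (hF.isCompact q.1) (hF.nonempty _) (hF.isCompact x)
      (hF.exists_near q.1 x) (hF.norm_le x) q.2 p
    have h2 := ham_sub_le (hF.isCompact x) (hF.nonempty _) (hF.isCompact q.1)
      (hF.exists_near x q.1) (hF.norm_le q.1) p q.2
    rw [norm_sub_rev p, norm_sub_rev x] at h2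
    have h3 : 0 ≤ L * ‖q.1 - x‖ * ‖q.2‖ := by positivity
    have h4 : 0 ≤ L * ‖q.1 - x‖ * ‖p‖ := by positivity
    rw [abs_le]
    constructor <;> linarith
  have hlim : Tendsto (fun q : E × E => M * ‖q.2 - p‖ + L * ‖q.1 - x‖ * (‖q.2‖ + ‖p‖))
      (𝓝 (x, p)) (𝓝 0) := by
    apply Continuous.tendsto' (by fun_prop)
    simp
  exact tendsto_iff_norm_sub_tendsto_zero.2
    (squeeze_zero (fun _ => norm_nonneg _) (fun q => key q) hlim)

theorem continuous_infDist (hF : LipBddMap F L M) :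
    Continuous fun q : E × E => infDist q.2 (F q.1) := by
  have key : ∀ q q' : E × E, infDist q.2 (F q.1) - infDist q'.2 (F q'.1) ≤
      ‖q.2 - q'.2‖ + L * ‖q.1 - q'.1‖ := by
    intro q q'
    obtain ⟨w', hw', hd⟩ := (hF.isCompact q'.1).exists_infDist_eq_dist (hF.nonempty _) q'.2
    obtain ⟨w, hw, hd'⟩ := hF.exists_near q'.1 q.1 w' hw'
    have h1 : infDist q.2 (F q.1) ≤ ‖q.2 - w‖ := by
      rw [← dist_eq_norm]; exact infDist_le_dist_of_mem hw
    have h2 : ‖q.2 - w‖ ≤ ‖q.2 - q'.2‖ + ‖q'.2 - w'‖ + ‖w' - w‖ := by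
      have : q.2 - w = (q.2 - q'.2) + (q'.2 - w') + (w' - w) := by abel
      rw [this]; exact norm_add₃_le
    rw [hd, dist_eq_norm]
    rw [norm_sub_rev q'.1] at hd'
    linarith
  rw [continuous_iff_continuousAt]
  intro q'
  have hlim : Tendsto (fun q : E × E => ‖q.2 - q'.2‖ + L * ‖q.1 - q'.1‖) (𝓝 q') (𝓝 0) := by
    apply Continuous.tendsto' (by fun_prop)
    simp
  refine tendsto_iff_norm_sub_tendsto_zero.2
    (squeeze_zero (fun _ => norm_nonneg _) (fun q => ?_) hlim)
  have h1 := key q q'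
  have h2 := key q' q
  rw [norm_sub_rev q'.1, norm_sub_rev q'.2] at h2
  rw [Real.norm_eq_abs, abs_le]
  constructor <;> linarith

theorem isClosed_graph (hF : LipBddMap F L M) : IsClosed {q : E × E | q.2 ∈ F q.1} := by
  have : {q : E × E | q.2 ∈ F q.1} = {q : E × E | infDist q.2 (F q.1) = 0} := by
    ext q
    exact (hF.isCompact q.1).isClosed.mem_iff_infDist_zero (hF.nonempty _)
  rw [this]
  exact isClosed_eq hF.continuous_infDist continuous_const

theorem isClosed_maxFace_graph (hF : LipBddMap F L M) :
    IsClosed {q : (E × E) × E | q.2 ∈ maxFace F q.1.1 q.1.2} := by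
  have h1 : IsClosed {q : (E × E) × E | q.2 ∈ F q.1.2} :=
    hF.isClosed_graph.preimage (f := fun q : (E × E) × E => (q.1.2, q.2)) (by fun_prop)
  have h2 : IsClosed {q : (E × E) × E | ⟪q.2, q.1.1⟫ = Ham F q.1.2 q.1.1} :=
    isClosed_eq (by fun_prop)
      (hF.continuous_ham.comp (f := fun q : (E × E) × E => (q.1.2, q.1.1)) (by fun_prop))
  exact h1.inter h2

/-- The nearest point selection of `F`. -/
theorem exists_selection_nearest [ProperSpace E] (hF : LipBddMap F L M) :
    ∃ S : E → E → E, Continuous (fun q : E × E => S q.1 q.2) ∧ (∀ x v, S x v ∈ F x) ∧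
      ∀ x z v, v ∈ F z → ‖S x v - v‖ ≤ L * ‖x - z‖ := by
  choose S hS hS' using fun x v => (hF.isCompact x).exists_infDist_eq_dist (hF.nonempty x) v
  refine ⟨S, ?_, hS, fun x z v hv => ?_⟩
  · refine continuous_of_isClosed_graph_of_norm_le (M := M) (fun q => hF.norm_le _ _ (hS _ _))
      (g := {r : (E × E) × E | r.2 ∈ F r.1.1 ∧ ‖r.1.2 - r.2‖ ≤ infDist r.1.2 (F r.1.1)}) ?_ ?_
    · refine IsClosed.inter (hF.isClosed_graph.preimage
        (f := fun q : (E × E) × E => (q.1.1, q.2)) (by fun_prop)) (isClosed_le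
          (f := fun q : (E × E) × E => ‖q.1.2 - q.2‖) (by fun_prop) ?_)
      exact hF.continuous_infDist.comp continuous_fst
    · rintro ⟨x, v⟩ w
      have hS'' : ‖v - S x v‖ ≤ infDist v (F x) := by rw [hS' x v, dist_eq_norm]
      constructor
      · rintro ⟨h1, h2⟩
        have := norm_sub_le_of_norm_le_infDist (hF.convex x) h1 h2 (hS x v) hS''
        simpa [sub_eq_zero] using this
      · rintro rfl
        exact ⟨hS x v, hS''⟩
  · obtain ⟨w, hw, hd⟩ := hF.exists_near z x v hv
    rw [norm_sub_rev, ← dist_eq_norm, ← hS' x v, norm_sub_rev x]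
    exact (infDist_le_dist_of_mem hw).trans (by rwa [dist_eq_norm])

end LipBddMap

/-- Where the Hamiltonian is differentiable in `p`, its gradient is the only maximizer. -/
theorem eq_of_mem_maxFace {F : E → Set E} {x p v g : E} (hF : IsCompact (F x))
    (hg : HasGradientAt (fun q => Ham F x q) g p) (hv : v ∈ maxFace F p x) : v = g := by
  have hmin : IsLocalMin (fun q => Ham F x q - ⟪v, q⟫) p := by
    refine Eventually.of_forall fun q => ?_
    have h1 := inner_le_ham hF hv.1 q
    have h2 := hv.2
    simp only
    linarith
  have hd := hg.hasFDerivAt.sub (innerSL ℝ v).hasFDerivAt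
  have h0 := hmin.hasFDerivAt_eq_zero hd
  have h1 := DFunLike.congr_fun h0 (g - v)
  simp only [sub_apply, InnerProductSpace.toDual_apply_apply,
    innerSL_apply_apply, zero_apply, ← inner_sub_left] at h1
  exact (sub_eq_zero.1 (inner_self_eq_zero.1 h1)).symm

theorem mem_maxFace_iff_of_hasGradientAt {F : E → Set E} {x p v g : E} (hF : IsCompact (F x))
    (hne : (F x).Nonempty) (hg : HasGradientAt (fun q => Ham F x q) g p) :
    v ∈ maxFace F p x ↔ v = g := by
  refine ⟨eq_of_mem_maxFace hF hg, ?_⟩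
  rintro rfl
  obtain ⟨w, hw, hw'⟩ := exists_inner_eq_ham hF hne p
  have : w ∈ maxFace F p x := ⟨hw, hw'⟩
  rwa [eq_of_mem_maxFace hF hg this] at this

end SetValued

section Hypotheses

theorem StandingHyp.exists_lipschitz {F : E → Set E} (hF : StandingHyp F) {K : Set E}
    (hK : IsCompact K) : ∃ L : ℝ, 0 ≤ L ∧ ∀ x ∈ K, ∀ y ∈ K, ∀ v ∈ F x,
      ∃ w ∈ F y, ‖v - w‖ ≤ L * ‖x - y‖ := by
  obtain ⟨h1, h2, -⟩ := hF
  let Φ : E → TopologicalSpace.NonemptyCompacts E := fun x => ⟨⟨F x, (h1 x).2.2⟩, (h1 x).1⟩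
  have hΦ : LocallyLipschitz Φ := by
    intro x
    obtain ⟨ε, hε, c, hc, h⟩ := h2 x
    refine ⟨c.toNNReal, ball x ε, ball_mem_nhds x hε, fun y hy z hz => (h y hy z hz).trans_eq ?_⟩
    rw [ENNReal.ofReal_mul hc, ← edist_dist]
    rfl
  obtain ⟨L, hL⟩ := LocallyLipschitzOn.exists_lipschitzOnWith_of_compact hK hΦ.locallyLipschitzOn
  refine ⟨L, L.2, fun x hx y hy v hv => ?_⟩
  obtain ⟨w, hw, hd⟩ := (h1 y).2.2.exists_infDist_eq_dist (h1 y).1 v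
  refine ⟨w, hw, ?_⟩
  rw [← dist_eq_norm, ← hd]
  have h3 : infDist v (F y) ≤ hausdorffDist (F x) (F y) :=
    infDist_le_hausdorffDist_of_mem hv (hausdorffEDist_ne_top_of_nonempty_of_bounded (h1 x).1
      (h1 y).1 (h1 x).2.2.isBounded (h1 y).2.2.isBounded)
  have h4 := hL.dist_le_mul x hx y hy
  rw [dist_eq_norm x y] at h4
  exact h3.trans h4

theorem StandingHyp.lipBddMap_comp {F : E → Set E} (hF : StandingHyp F) {R L : ℝ} (hL : 0 ≤ L)
    (hFL : ∀ x ∈ closedBall (0 : E) R, ∀ y ∈ closedBall (0 : E) R, ∀ v ∈ F x,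
      ∃ w ∈ F y, ‖v - w‖ ≤ L * ‖x - y‖) {P : E → E} (hP : ∀ x, P x ∈ closedBall (0 : E) R)
    (hP1 : ∀ x y, ‖P x - P y‖ ≤ ‖x - y‖) : ∃ M, 0 ≤ M ∧ LipBddMap (fun x => F (P x)) L M := by
  obtain ⟨h1, -, r, hr, h3⟩ := hF
  have hR : 0 ≤ R := nonempty_closedBall.1 ⟨_, hP 0⟩
  refine ⟨r * (1 + R), by positivity, fun x => (h1 _).1, fun x => (h1 _).2.1, fun x => (h1 _).2.2,
    fun x y v hv => ?_, fun x v hv => ?_, hL⟩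
  · obtain ⟨w, hw, h⟩ := hFL _ (hP x) _ (hP y) v hv
    exact ⟨w, hw, h.trans (by gcongr; exact hP1 x y)⟩
  · refine (h3 _ v hv).trans ?_
    have := hP x
    rw [mem_closedBall_zero_iff] at this
    gcongr

/-- A selection of the maximizing faces along a continuous arc `p` which either never vanishes or
vanishes identically. -/
theorem exists_maxFace_selection [ProperSpace E] {F : E → Set E} (hH1 : HypH1 F) {R L M : ℝ}
    {P : E → E} (hP : ∀ x, P x ∈ closedBall (0 : E) R) (hP1 : ∀ x y, ‖P x - P y‖ ≤ ‖x - y‖)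
    (hF : LipBddMap (fun x => F (P x)) L M) {p : ℝ → E} (hp : Continuous p) {Q : Set E}
    (hQ : IsCompact Q) (hpQ : ∀ s, p s ∈ Q) (h0 : (0 : E) ∉ Q ∨ ∀ s, p s = 0) :
    ∃ S : ℝ → E → E → E, Continuous (fun q : ℝ × E × E => S q.1 q.2.1 q.2.2) ∧
      (∀ s x v, S s x v ∈ maxFace (fun x => F (P x)) (p s) x) ∧
      ∃ L', 0 ≤ L' ∧ ∀ s x z v, v ∈ maxFace (fun x => F (P x)) (p s) z →
        ‖S s x v - v‖ ≤ L' * ‖x - z‖ := by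
  rcases h0 with h0 | h0
  · obtain ⟨-, hg, hLip⟩ := hH1
    have hR : 0 ≤ R := nonempty_closedBall.1 ⟨_, hP 0⟩
    obtain ⟨L', hL'⟩ := hLip (closedBall 0 R) (nonempty_closedBall.2 hR) (convex_closedBall _ _)
      (isCompact_closedBall _ _) Q hQ h0
    have hp0 : ∀ s, p s ≠ 0 := fun s h => h0 (h ▸ hpQ s)
    have hiff : ∀ s x v, v ∈ maxFace (fun x => F (P x)) (p s) x ↔ v = gradpH F (P x) (p s) :=
      fun s x v => mem_maxFace_iff_of_hasGradientAt (F := fun x => F (P x)) (hF.isCompact x)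
        (hF.nonempty x) (hg (P x) (p s) (hp0 s))
    refine ⟨fun s x _ => gradpH F (P x) (p s), ?_, fun s x v => (hiff s x _).2 rfl, L', L'.2, ?_⟩
    · refine continuous_of_isClosed_graph_of_norm_le (M := M)
        (fun q => hF.norm_le q.2.1 _ ((hiff q.1 q.2.1 _).2 rfl).1)
        (g := {r : (ℝ × E × E) × E | r.2 ∈ maxFace (fun x => F (P x)) (p r.1.1) r.1.2.1}) ?_ ?_
      · exact hF.isClosed_maxFace_graph.preimage
          (f := fun r : (ℝ × E × E) × E => ((p r.1.1, r.1.2.1), r.2)) (by fun_prop)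
      · rintro ⟨s, x, v⟩ w
        exact hiff s x w
    · intro s x z v hv
      rw [(hiff s z v).1 hv]
      have := (hL' (p s) (hpQ s)).dist_le_mul _ (hP x) _ (hP z)
      rw [dist_eq_norm, dist_eq_norm] at this
      exact this.trans (by gcongr; exact hP1 x z)
  · obtain ⟨S, hS, hS1, hS2⟩ := hF.exists_selection_nearest
    refine ⟨fun _ x v => S x v, hS.comp continuous_snd, fun s x v => ⟨hS1 x v, ?_⟩, L,
      hF.const_nonneg, fun s x z v hv => hS2 x z v hv.1⟩
    rw [h0 s, inner_zero_right, ham_zero (F := fun x => F (P x)) (hF.nonempty x)]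

/-- A Fréchet subgradient of a semiconvex function satisfies a global quadratic lower bound. -/
theorem SemiconvexWith.le_of_mem_fSub {f : E → ℝ} {K : Set E} {c : ℝ} (hc : 0 ≤ c)
    (hK : Convex ℝ K) (hf : SemiconvexWith f K c) {x y ζ : E} (hx : x ∈ K) (hy : y ∈ K)
    (hζ : ζ ∈ FSub f x) : ⟪ζ, y - x⟫ - c * ‖y - x‖ ^ 2 ≤ f y - f x := by
  set d := y - x with hd
  have hmem : ∀ l : ℝ, 0 ≤ l → l ≤ 1 → x + l • d ∈ K := fun l h0 h1 =>
    hK.add_smul_sub_mem hx hy ⟨h0, h1⟩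
  set θ : ℝ → ℝ := fun l => f (x + l • d) - f x - l * ⟪ζ, d⟫ with hθ
  have hhalf : ∀ l : ℝ, 0 ≤ l → l ≤ 1 → 2 * θ (l / 2) - c * l ^ 2 / 4 * ‖d‖ ^ 2 ≤ θ l := by
    intro l h0 h1
    have h2 := hf (x + (l / 2) • d) ((l / 2) • d)
    have e1 : x + (l / 2) • d + (l / 2) • d = x + l • d := by
      rw [add_assoc, ← add_smul, add_halves]
    rw [e1, add_sub_cancel_right, norm_smul, mul_pow, Real.norm_eq_abs, sq_abs] at h2
    have h3 := h2 (hmem l h0 h1) hx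
    simp only [hθ]
    linarith
  have hiter : ∀ k : ℕ, 2 ^ k * θ (1 / 2 ^ k) - c * ‖d‖ ^ 2 * (1 - 1 / 2 ^ k) / 2 ≤ θ 1 := by
    intro k
    induction k with
    | zero => simp
    | succ k ih =>
      refine le_trans ?_ ih
      have h1 := hhalf (1 / 2 ^ k) (by positivity)
        (by rw [div_le_one (by positivity)]; exact one_le_pow₀ (by norm_num))
      have h2 : (1 : ℝ) / 2 ^ k / 2 = 1 / 2 ^ (k + 1) := by rw [pow_succ]; field_simp
      rw [h2] at h1
      have h3 : (0 : ℝ) < 2 ^ k := by positivity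
      have h4 := mul_le_mul_of_nonneg_left h1 h3.le
      have h5 : (2 : ℝ) ^ k * (c * (1 / 2 ^ k) ^ 2 / 4 * ‖d‖ ^ 2) =
        c * ‖d‖ ^ 2 * (1 / 2 ^ k) / 4 := by field_simp
      have h6 : (1 : ℝ) / 2 ^ (k + 1) = (1 / 2 ^ k) / 2 := h2.symm
      have h7 : (2 : ℝ) ^ (k + 1) * θ (1 / 2 ^ (k + 1)) =
          2 ^ k * (2 * θ (1 / 2 ^ (k + 1))) := by ring
      rw [mul_sub, h5] at h4
      have h8 : c * ‖d‖ ^ 2 * (1 - 1 / 2 ^ (k + 1)) / 2 =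
          c * ‖d‖ ^ 2 * (1 - 1 / 2 ^ k) / 2 + c * ‖d‖ ^ 2 * (1 / 2 ^ k) / 4 := by
        rw [h6]; ring
      rw [h7, h8]
      linarith
  have hlower : -(c * ‖d‖ ^ 2) ≤ θ 1 := by
    refine le_of_forall_pos_sub_le fun ε hε => ?_
    have h1 := hζ (ε / (‖d‖ + 1)) (by positivity)
    have hlim : Tendsto (fun k : ℕ => x + ((1 : ℝ) / 2 ^ k) • d) atTop (𝓝 x) := by
      have h2 : Tendsto (fun k : ℕ => (1 : ℝ) / 2 ^ k) atTop (𝓝 0) := by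
        simpa using tendsto_pow_atTop_nhds_zero_of_lt_one (r := (1 : ℝ) / 2) (by norm_num)
          (by norm_num)
      simpa using (h2.smul_const d).const_add x
    obtain ⟨k, hk⟩ := (hlim.eventually h1).exists
    have h3 := hiter k
    have hk0 : (0 : ℝ) < 2 ^ k := by positivity
    rw [add_sub_cancel_left, norm_smul, inner_smul_right, Real.norm_of_nonneg (by positivity)] at hk
    have h4 : -(ε / (‖d‖ + 1) * ‖d‖) ≤ 2 ^ k * θ (1 / 2 ^ k) := by
      have h5 := mul_le_mul_of_nonneg_left hk hk0.le
      refine le_trans (le_of_eq ?_) h5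
      field_simp
    have h6 : ε / (‖d‖ + 1) * ‖d‖ ≤ ε := by
      rw [div_mul_eq_mul_div, div_le_iff₀ (by positivity)]
      nlinarith
    have h7 : c * ‖d‖ ^ 2 * (1 - 1 / 2 ^ k) / 2 ≤ c * ‖d‖ ^ 2 := by
      have h8 : 0 ≤ c * ‖d‖ ^ 2 := by positivity
      have h9 : 0 ≤ (1 : ℝ) / 2 ^ k := by positivity
      nlinarith
    linarith
  simp only [hθ, one_smul, one_mul] at hlower
  rw [hd, add_sub_cancel, ← hd] at hlower
  linarith

/-- Fréchet subgradients are bounded by any local Lipschitz constant. -/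
theorem norm_le_of_mem_fSub {f : E → ℝ} {x ζ : E} {C : ℝ} (hC : 0 ≤ C)
    (hf : ∀ᶠ y in 𝓝 x, f y - f x ≤ C * ‖y - x‖) (hζ : ζ ∈ FSub f x) : ‖ζ‖ ≤ C := by
  refine le_of_forall_pos_le_add fun ε hε => ?_
  rcases eq_or_ne ζ 0 with rfl | h0
  · simp; positivity
  have hlim : Tendsto (fun l : ℝ => x + l • ζ) (𝓝[>] 0) (𝓝 x) := by
    have : Tendsto (fun l : ℝ => x + l • ζ) (𝓝 0) (𝓝 x) := by
      apply Continuous.tendsto' (by fun_prop); simp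
    exact this.mono_left nhdsWithin_le_nhds
  obtain ⟨l, ⟨h1, h2⟩, hl⟩ := ((hlim.eventually (hf.and (hζ ε hε))).and
    self_mem_nhdsWithin).exists
  have hl' : (0 : ℝ) < l := hl
  rw [add_sub_cancel_left, norm_smul, inner_smul_right, Real.norm_of_nonneg hl'.le,
    real_inner_self_eq_norm_mul_norm] at h2
  rw [add_sub_cancel_left, norm_smul, Real.norm_of_nonneg hl'.le] at h1
  have h3 : 0 < l * ‖ζ‖ := mul_pos hl' (norm_pos_iff.2 h0)
  have h4 : (l * ‖ζ‖) * ‖ζ‖ ≤ (l * ‖ζ‖) * (C + ε) := by linarith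
  exact le_of_mul_le_mul_left h4 h3

/-- A Clarke gradient of the Hamiltonian in `p` maximizes over `F x`. -/
theorem ham_le_inner_of_mem_clarkeGrad {F : E → Set E} {x p ζ : E} {M : ℝ}
    (hF : IsCompact (F x)) (hne : (F x).Nonempty) (hM : ∀ v ∈ F x, ‖v‖ ≤ M)
    (hζ : ζ ∈ ClarkeGrad (fun q => Ham F x q) p) : Ham F x p ≤ ⟪ζ, p⟫ := by
  have hM0 : 0 ≤ M := (norm_nonneg _).trans (hM _ hne.some_mem)
  have hL : ∀ q q', Ham F x q - Ham F x q' ≤ M * ‖q - q'‖ := fun q q' => by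
    simpa using ham_sub_le hF hne hF (d := 0) (fun v hv => ⟨v, hv, by simp⟩) hM q q'
  have hconv : ∀ (h : ℝ) (q : E), 0 ≤ h → h ≤ 1 →
      Ham F x (q + h • (-p)) ≤ (1 - h) * Ham F x q + h * Ham F x (q - p) := by
    intro h q h0 h1
    obtain ⟨v, hv, hv'⟩ := exists_inner_eq_ham hF hne (q + h • (-p))
    rw [← hv']
    have e : ⟪v, q + h • (-p)⟫ = (1 - h) * ⟪v, q⟫ + h * ⟪v, q - p⟫ := by
      simp only [inner_add_right, inner_smul_right, inner_neg_right, inner_sub_right]; ring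
    rw [e]
    have := inner_le_ham hF hv q
    have := inner_le_ham hF hv (q - p)
    have : 0 ≤ 1 - h := by linarith
    gcongr
  refine le_of_forall_pos_le_add fun ε hε => ?_
  have hfr := hζ (-p) (ε / 2) (by positivity)
  have hev : ∀ᶠ q : E × ℝ in (𝓝 p) ×ˢ (𝓝[>] (0 : ℝ)),
      2 * M * ‖q.1 - p‖ < ε / 2 ∧ 0 < q.2 ∧ q.2 < 1 := by
    have h1 : ∀ᶠ q in 𝓝 p, 2 * M * ‖q - p‖ < ε / 2 := by
      have : Tendsto (fun q : E => 2 * M * ‖q - p‖) (𝓝 p) (𝓝 0) := by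
        apply Continuous.tendsto' (by fun_prop); simp
      exact this.eventually_lt_const (by positivity)
    have h2 : ∀ᶠ h : ℝ in 𝓝[>] 0, 0 < h ∧ h < 1 := Ioo_mem_nhdsGT one_pos
    exact h1.prod_mk h2
  obtain ⟨⟨q, h⟩, h1, h2, h3, h4⟩ := (hfr.and_eventually hev).exists
  simp only at h1 h2 h3 h4
  have h5 := hconv h q h3.le h4.le
  have h6 : (Ham F x (q + h • (-p)) - Ham F x q) / h ≤ Ham F x (q - p) - Ham F x q := by
    rw [div_le_iff₀ h3]; linarith
  have h7 := hL (q - p) 0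
  have h8 := hL p q
  rw [ham_zero hne, sub_zero, sub_zero] at h7
  rw [norm_sub_rev] at h8
  rw [inner_neg_right] at h1
  linarith

end Hypotheses

section Arcs

/-- The integral form of Grönwall's inequality. -/
theorem le_mul_exp_of_le_add_integral {f : ℝ → ℝ} {a b A K : ℝ} (hK : 0 ≤ K)
    (hf : ContinuousOn f (Icc a b))
    (h : ∀ s ∈ Icc a b, f s ≤ A + K * ∫ r in a..s, f r) :
    ∀ s ∈ Icc a b, f s ≤ A * Real.exp (K * (s - a)) := by
  intro s hs
  have hab : a ≤ b := hs.1.trans hs.2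
  set f₁ : ℝ → ℝ := fun r => f (projIcc a b hab r) with hf₁
  have hc : Continuous f₁ :=
    (continuousOn_iff_continuous_domRestrict.1 hf).comp (continuous_projIcc (h := hab))
  have heq : ∀ r ∈ Icc a b, f₁ r = f r := fun r hr => by simp [hf₁, projIcc_of_mem hab hr]
  set g : ℝ → ℝ := fun r => A + K * ∫ q in a..r, f₁ q with hg
  have hder : ∀ r, HasDerivAt g (K * f₁ r) r := fun r =>
    ((intervalIntegral.integral_hasDerivAt_right (hc.intervalIntegrable _ _)
      (hc.stronglyMeasurableAtFilter _ _) hc.continuousAt).const_mul K).const_add A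
  have hle : ∀ r ∈ Icc a b, f₁ r ≤ g r := by
    intro r hr
    rw [heq r hr]
    refine (h r hr).trans_eq ?_
    simp only [hg]
    congr 2
    refine intervalIntegral.integral_congr fun q hq => (heq q ?_).symm
    rw [uIcc_of_le hr.1] at hq
    exact ⟨hq.1, hq.2.trans hr.2⟩
  have := le_gronwallBound_of_liminf_deriv_right_le (f := g) (f' := fun r => K * f₁ r) (δ := A)
    (K := K) (ε := 0) (a := a) (b := b)
    (fun r _ => (hder r).continuousAt.continuousWithinAt)
    (fun r _ q hq => by
      simpa [slope_def_field, div_eq_inv_mul] using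
        (hder r).hasDerivWithinAt.liminf_right_slope_le hq)
    (by simp [hg]) (fun r hr => by
      rw [add_zero]
      exact mul_le_mul_of_nonneg_left (hle r (Ico_subset_Icc_self hr)) hK) s hs
  rw [gronwallBound_ε0] at this
  rw [← heq s hs]
  exact (hle s hs).trans this

theorem ACArc.continuousOn {a b : ℝ} {x x' : ℝ → E} (hx : ACArc a b x x') (hab : a ≤ b) :
    ContinuousOn x (Icc a b) :=
  (continuousOn_primitive_Icc hab hx.1 (x a)).congr hx.2.1

theorem ACArc.integral_eq_sub {a b c d : ℝ} {x x' : ℝ → E} (hx : ACArc a b x x') (hac : a ≤ c)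
    (hcd : c ≤ d) (hdb : d ≤ b) : ∫ r in c..d, x' r = x d - x c := by
  rw [hx.2.1 d ⟨hac.trans hcd, hdb⟩, hx.2.1 c ⟨hac, hcd.trans hdb⟩,
    ← intervalIntegral.integral_add_adjacent_intervals
      (hx.1.mono_Icc le_rfl hac (hcd.trans hdb)) (hx.1.mono_Icc hac hcd hdb)]
  abel

theorem ACArc.mono {a b c d : ℝ} {x x' : ℝ → E} (hx : ACArc a b x x') (hac : a ≤ c)
    (hcd : c ≤ d) (hdb : d ≤ b) : ACArc c d x x' := by
  refine ⟨hx.1.mono_Icc hac hcd hdb, fun s hs => ?_, ?_⟩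
  · rw [hx.integral_eq_sub hac hs.1 (hs.2.trans hdb)]; abel
  · filter_upwards [hx.2.2] with s h hs
    exact h ⟨hac.trans hs.1, hs.2.trans hdb⟩

theorem IsTraj.mono {F : E → Set E} {a b c d : ℝ} {x x' : ℝ → E} (hx : IsTraj F a b x x')
    (hac : a ≤ c) (hcd : c ≤ d) (hdb : d ≤ b) : IsTraj F c d x x' := by
  refine ⟨hx.1.mono hac hcd hdb, ?_⟩
  filter_upwards [hx.2] with s h hs
  exact h ⟨hac.trans hs.1, hs.2.trans hdb⟩

/-- Two trajectories with a common endpoint can be concatenated. -/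
theorem IsTraj.concat {F : E → Set E} {a b c : ℝ} (hab : a ≤ b) (hbc : b ≤ c)
    {x x' y y' : ℝ → E} (hx : IsTraj F a b x x') (hy : IsTraj F b c y y') (hxy : x b = y b) :
    IsTraj F a c (fun s => if s ≤ b then x s else y s) (fun s => if s ≤ b then x' s else y' s) := by
  set z : ℝ → E := fun s => if s ≤ b then x s else y s with hz
  set z' : ℝ → E := fun s => if s ≤ b then x' s else y' s with hz'
  have hl : ∀ s, s ≤ b → z s = x s := fun s hs => if_pos hs
  have hr : ∀ s, b ≤ s → z s = y s := fun s hs => by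
    rcases hs.eq_or_lt with rfl | hs
    · rw [hl _ le_rfl, hxy]
    · exact if_neg hs.not_ge
  have hl' : ∀ s, s ≤ b → z' s = x' s := fun s hs => if_pos hs
  have hr' : ∀ s, b < s → z' s = y' s := fun s hs => if_neg hs.not_ge
  have hi1 : IntervalIntegrable z' volume a b := by
    refine hx.1.1.congr fun s hs => ?_
    rw [uIoc_of_le hab] at hs
    exact (hl' s hs.2).symm
  have hi2 : IntervalIntegrable z' volume b c := by
    refine hy.1.1.congr fun s hs => ?_
    rw [uIoc_of_le hbc] at hs
    exact (hr' s hs.1).symm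
  have hne : ∀ᵐ s : ℝ, s ≠ b := by simp [ae_iff, measure_singleton]
  have hI1 : ∀ s, a ≤ s → s ≤ b → ∫ r in a..s, z' r = x s - x a := fun s h1 h2 => by
    rw [← hx.1.integral_eq_sub le_rfl h1 h2]
    refine intervalIntegral.integral_congr fun q hq => hl' q ?_
    rw [uIcc_of_le h1] at hq
    exact hq.2.trans h2
  have hI2 : ∀ s, b ≤ s → s ≤ c → ∫ r in b..s, z' r = y s - y b := fun s h1 h2 => by
    rw [← hy.1.integral_eq_sub le_rfl h1 h2]
    refine intervalIntegral.integral_congr_ae (Eventually.of_forall fun q hq => hr' q ?_)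
    rw [uIoc_of_le h1] at hq
    exact hq.1
  refine ⟨⟨hi1.trans hi2, fun s hs => ?_, ?_⟩, ?_⟩
  · rw [hl a hab]
    rcases le_total s b with h | h
    · rw [hl s h, hI1 s hs.1 h]; abel
    · rw [hr s h, ← intervalIntegral.integral_add_adjacent_intervals hi1
        (hi2.mono_Icc le_rfl h hs.2), hI1 b hab le_rfl, hI2 s h hs.2, hxy]; abel
  · filter_upwards [hx.1.2.2, hy.1.2.2, hne] with s h1 h2 h3 hs
    rcases lt_or_gt_of_ne h3 with h | h
    · rw [hl' s h.le]
      refine (h1 ⟨hs.1, h.le⟩).congr_of_eventuallyEq ?_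
      filter_upwards [Iio_mem_nhds h] with q hq
      exact hl q (le_of_lt hq)
    · rw [hr' s h]
      refine (h2 ⟨h.le, hs.2⟩).congr_of_eventuallyEq ?_
      filter_upwards [Ioi_mem_nhds h] with q hq
      exact hr q (le_of_lt hq)
  · filter_upwards [hx.2, hy.2, hne] with s h1 h2 h3 hs
    rcases lt_or_gt_of_ne h3 with h | h
    · rw [hl' s h.le, hl s h.le]
      exact h1 ⟨hs.1, h.le⟩
    · rw [hr' s h, hr s h.le]
      exact h2 ⟨h.le, hs.2⟩

/-- A priori bound for trajectories. -/
theorem IsTraj.norm_le {F : E → Set E} {a b k : ℝ} (hk : 0 ≤ k)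
    (hF : ∀ x : E, ∀ v ∈ F x, ‖v‖ ≤ k * (1 + ‖x‖)) (hab : a ≤ b) {x x' : ℝ → E}
    (hx : IsTraj F a b x x') : 1 + ‖x b‖ ≤ (1 + ‖x a‖) * Real.exp (k * (b - a)) := by
  have hc := hx.1.continuousOn hab
  have hc1 : ContinuousOn (fun s => 1 + ‖x s‖) (Icc a b) := continuousOn_const.add hc.norm
  refine le_mul_exp_of_le_add_integral (f := fun s => 1 + ‖x s‖) hk hc1 ?_ b ⟨hab, le_rfl⟩
  intro s hs
  have h1 : ‖∫ r in a..s, x' r‖ ≤ ∫ r in a..s, k * (1 + ‖x r‖) := by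
    apply intervalIntegral.norm_integral_le_of_norm_le hs.1
    · filter_upwards [hx.2] with r hr hrI
      exact hF _ _ (hr ⟨hrI.1.le, hrI.2.trans hs.2⟩)
    · apply ContinuousOn.intervalIntegrable
      rw [uIcc_of_le hs.1]
      exact continuousOn_const.mul (hc1.mono (Icc_subset_Icc_right hs.2))
  rw [intervalIntegral.integral_const_mul] at h1
  have h2 : ‖x s‖ ≤ ‖x a‖ + ‖∫ r in a..s, x' r‖ := by
    conv_lhs => rw [hx.1.2.1 s hs]
    exact norm_add_le _ _
  linarith

/-- An arc with `‖p'‖ ≤ c ‖p‖` which vanishes somewhere vanishes identically. -/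
theorem ACArc.eq_zero {a b c : ℝ} (hc : 0 ≤ c) {p p' : ℝ → E} (hp : ACArc a b p p')
    (h : ∀ᵐ s, s ∈ Icc a b → ‖p' s‖ ≤ c * ‖p s‖) {r : ℝ} (hr : r ∈ Icc a b) (hr0 : p r = 0) :
    ∀ s ∈ Icc a b, p s = 0 := by
  have hcont := (hp.continuousOn (hr.1.trans hr.2)).norm
  have key : ∀ s t, a ≤ s → s ≤ t → t ≤ b → ‖p t - p s‖ ≤ c * ∫ q in s..t, ‖p q‖ := by
    intro s t has hst htb
    rw [← hp.integral_eq_sub has hst htb, ← intervalIntegral.integral_const_mul]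
    apply intervalIntegral.norm_integral_le_of_norm_le hst
    · filter_upwards [h] with q hq hqI
      exact hq ⟨has.trans hqI.1.le, hqI.2.trans htb⟩
    · apply ContinuousOn.intervalIntegrable
      rw [uIcc_of_le hst]
      exact continuousOn_const.mul (hcont.mono (Icc_subset_Icc has htb))
  intro s hs
  rw [← norm_le_zero_iff]
  rcases le_total r s with hrs | hrs
  · have := le_mul_exp_of_le_add_integral (f := fun s => ‖p s‖) (A := 0) (a := r) (b := b) hc
      (hcont.mono (Icc_subset_Icc_left hr.1)) (fun t ht => by
        have := key r t hr.1 ht.1 ht.2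
        rw [hr0, sub_zero] at this
        rwa [zero_add]) s ⟨hrs, hs.2⟩
    simpa using this
  · have := le_mul_exp_of_le_add_integral (f := fun s => ‖p (a + r - s)‖) (A := 0) (a := a)
      (b := r) hc
      (hcont.comp (f := fun s => a + r - s) (by fun_prop)
        (fun t ht => ⟨by linarith [ht.2], by linarith [ht.1, hr.2]⟩)) (fun t ht => by
        have := key (a + r - t) r (by linarith [ht.2]) (by linarith [ht.1]) hr.2
        rw [hr0, zero_sub, norm_neg] at this
        rw [zero_add, intervalIntegral.integral_comp_sub_left (fun q => ‖p q‖)]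
        simpa using this) (a + r - s) ⟨by linarith, by linarith [hs.1]⟩
    simpa using this

end Arcs

section ProductRule

theorem absolutelyContinuousOnInterval_const_add_integral {a b : ℝ} {u : ℝ → ℝ}
    (hu : IntervalIntegrable u volume a b) (c : ℝ) :
    AbsolutelyContinuousOnInterval (fun s => c + ∫ r in a..s, u r) a b :=
  ((LipschitzWith.const c).lipschitzOnWith (s := uIcc a b)).absolutelyContinuousOnInterval.add
    (hu.absolutelyContinuousOnInterval_intervalIntegral left_mem_uIcc)

theorem primitive_apply {n : ℕ} {a b s : ℝ} {u : ℝ → Euc n} (hu : IntervalIntegrable u volume a b)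
    (hs : s ∈ uIcc a b) (p0 : Euc n) (i : Fin n) :
    (p0 + ∫ r in a..s, u r) i = p0 i + ∫ r in a..s, u r i := by
  have hu' : IntervalIntegrable u volume a s := hu.mono_set (uIcc_subset_uIcc left_mem_uIcc hs)
  have := ContinuousLinearMap.intervalIntegral_comp_comm
    (EuclideanSpace.proj i : Euc n →L[ℝ] ℝ) hu'
  rw [PiLp.add_apply]
  exact congrArg (p0 i + ·) this.symm

theorem absolutelyContinuousOnInterval_congr {f g : ℝ → ℝ} {a b : ℝ}
    (hf : AbsolutelyContinuousOnInterval f a b) (h : EqOn f g (uIcc a b)) :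
    AbsolutelyContinuousOnInterval g a b := by
  have h0 : AbsolutelyContinuousOnInterval (fun s => g s - f s) a b := by
    have : LipschitzOnWith 0 (fun s => g s - f s) (uIcc a b) := fun s hs t ht => by
      simp [h hs, h ht]
    exact this.absolutelyContinuousOnInterval
  have hfg : g = (fun s => g s - f s) + f := by
    ext s
    simp
  rw [hfg]
  exact h0.add hf

theorem absolutelyContinuousOnInterval_inner {n : ℕ} {a b : ℝ} {u v : ℝ → Euc n}
    (hu : IntervalIntegrable u volume a b) (hv : IntervalIntegrable v volume a b)
    (p0 z0 : Euc n) :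
    AbsolutelyContinuousOnInterval
      (fun s => ⟪p0 + ∫ r in a..s, u r, z0 + ∫ r in a..s, v r⟫) a b := by
  have hcoord : ∀ (w : ℝ → Euc n), IntervalIntegrable w volume a b → ∀ i,
      IntervalIntegrable (fun r => w r i) volume a b := fun w hw i =>
    ⟨(EuclideanSpace.proj i : Euc n →L[ℝ] ℝ).integrable_comp hw.1,
      (EuclideanSpace.proj i : Euc n →L[ℝ] ℝ).integrable_comp hw.2⟩
  have hsum : ∀ t : Finset (Fin n), AbsolutelyContinuousOnInterval (fun s => ∑ i ∈ t,
      (z0 i + ∫ r in a..s, v r i) * (p0 i + ∫ r in a..s, u r i)) a b := by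
    intro t
    classical
    induction t using Finset.induction_on with
    | empty =>
      simpa using ((LipschitzWith.const (0 : ℝ)).lipschitzOnWith
        (s := uIcc a b)).absolutelyContinuousOnInterval
    | insert i t hi ih =>
      simp_rw [Finset.sum_insert hi]
      exact ((absolutelyContinuousOnInterval_const_add_integral (hcoord v hv i) _).mul
        (absolutelyContinuousOnInterval_const_add_integral (hcoord u hu i) _)).add ih
  refine absolutelyContinuousOnInterval_congr (hsum Finset.univ) fun s hs => ?_
  simp only [PiLp.inner_apply, primitive_apply hu hs, primitive_apply hv hs]
  simp

/-- A lower bound on the a.e. derivative of `⟪p, z⟫` bounds its increment from below. -/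
theorem ACArc.le_inner_sub_inner {n : ℕ} {a b C : ℝ} (hab : a ≤ b) {p p' z z' : ℝ → Euc n}
    (hp : ACArc a b p p') (hz : ACArc a b z z')
    (h : ∀ᵐ s, s ∈ Icc a b → -C ≤ ⟪p s, z' s⟫ + ⟪p' s, z s⟫) :
    -(C * (b - a)) ≤ ⟪p b, z b⟫ - ⟪p a, z a⟫ := by
  set g : ℝ → ℝ := fun s => ⟪p a + ∫ r in a..s, p' r, z a + ∫ r in a..s, z' r⟫ with hg
  have hAC : AbsolutelyContinuousOnInterval g a b :=
    absolutelyContinuousOnInterval_inner hp.1 hz.1 _ _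
  have hgeq : ∀ s ∈ Icc a b, g s = ⟪p s, z s⟫ := fun s hs => by
    simp only [hg]; rw [← hp.2.1 s hs, ← hz.2.1 s hs]
  rw [← hgeq b ⟨hab, le_rfl⟩, ← hgeq a ⟨le_rfl, hab⟩, ← hAC.integral_deriv_eq_sub]
  have hle : ∫ _ in a..b, -C ≤ ∫ s in a..b, deriv g s := by
    refine intervalIntegral.integral_mono_ae_restrict hab intervalIntegrable_const
      hAC.intervalIntegrable_deriv ?_
    filter_upwards [ae_restrict_of_ae h, ae_restrict_of_ae hp.1.ae_hasDerivAt_integral,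
      ae_restrict_of_ae hz.1.ae_hasDerivAt_integral, ae_restrict_mem measurableSet_Icc]
      with s h1 h2 h3 hs
    have hs' : s ∈ uIcc a b := by rwa [uIcc_of_le hab]
    have h4 := ((h2 hs' a left_mem_uIcc).const_add (p a)).inner ℝ
      ((h3 hs' a left_mem_uIcc).const_add (z a))
    rw [← hp.2.1 s hs, ← hz.2.1 s hs] at h4
    rw [show deriv g s = _ from h4.deriv]
    exact h1 hs
  simpa [mul_comm, mul_neg] using hle

end ProductRule

section ValueFunction

theorem ACArc.sub {a b : ℝ} {x x' y y' : ℝ → E} (hy : ACArc a b y y') (hx : ACArc a b x x') :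
    ACArc a b (fun s => y s - x s) (fun s => y' s - x' s) := by
  refine ⟨hy.1.sub hx.1, fun s hs => ?_, ?_⟩
  · rw [intervalIntegral.integral_sub (hy.1.mono_Icc le_rfl hs.1 hs.2)
      (hx.1.mono_Icc le_rfl hs.1 hs.2), hx.integral_eq_sub le_rfl hs.1 hs.2,
      hy.integral_eq_sub le_rfl hs.1 hs.2]
    beta_reduce
    abel
  · filter_upwards [hx.2.2, hy.2.2] with s h1 h2 hs
    exact (h2 hs).sub (h1 hs)

theorem ACArc.integral_eq_sub' {a b c d : ℝ} {x x' : ℝ → E} (hx : ACArc a b x x')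
    (hc : c ∈ Icc a b) (hd : d ∈ Icc a b) : ∫ r in c..d, x' r = x d - x c := by
  rcases le_total c d with h | h
  · exact hx.integral_eq_sub hc.1 h hd.2
  · rw [intervalIntegral.integral_symm, hx.integral_eq_sub hd.1 h hc.2, neg_sub]

theorem ACArc.norm_sub_le {a b c d M : ℝ} {x x' : ℝ → E} (hx : ACArc a b x x')
    (hM : ∀ᵐ s, s ∈ Icc a b → ‖x' s‖ ≤ M) (hc : c ∈ Icc a b) (hd : d ∈ Icc a b) :
    ‖x d - x c‖ ≤ M * |d - c| := by
  rw [← hx.integral_eq_sub' hc hd]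
  refine intervalIntegral.norm_integral_le_of_norm_le_const_ae ?_
  filter_upwards [hM] with r hr hrI
  exact hr (uIcc_subset_Icc hc hd (uIoc_subset_uIcc hrI))

/-- Along an adjoint arc `p` the pairing with the difference of two maximizing trajectories
decreases at most quadratically in their distance. -/
theorem inner_adjoint_sub_ge {n : ℕ} {F : Euc n → Set (Euc n)} {a b c B δ : ℝ} {K : Set (Euc n)}
    (hab : a ≤ b) (hc : 0 ≤ c) (hK : Convex ℝ K)
    (hsc : ∀ q, SemiconvexWith (fun z => Ham F z q) K (c * ‖q‖))
    {x x' y y' p p' : ℝ → Euc n} (hx : ACArc a b x x') (hy : ACArc a b y y') (hp : ACArc a b p p')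
    (hxK : ∀ s ∈ Icc a b, x s ∈ K) (hyK : ∀ s ∈ Icc a b, y s ∈ K)
    (hpB : ∀ s ∈ Icc a b, ‖p s‖ ≤ B) (hδ : ∀ s ∈ Icc a b, ‖y s - x s‖ ≤ δ)
    (hadj : ∀ᵐ s, s ∈ Icc a b → -p' s ∈ FSub (fun z => Ham F z (p s)) (x s))
    (hx' : ∀ᵐ s, s ∈ Icc a b → ⟪x' s, p s⟫ = Ham F (x s) (p s))
    (hy' : ∀ᵐ s, s ∈ Icc a b → ⟪y' s, p s⟫ = Ham F (y s) (p s)) :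
    -(c * B * δ ^ 2 * (b - a)) ≤ ⟪p b, y b - x b⟫ - ⟪p a, y a - x a⟫ := by
  refine hp.le_inner_sub_inner hab (hy.sub hx) ?_
  filter_upwards [hadj, hx', hy'] with s h1 h2 h3 hs
  have h4 := SemiconvexWith.le_of_mem_fSub (by positivity) hK (hsc (p s)) (hxK s hs) (hyK s hs)
    (h1 hs)
  rw [← h2 hs, ← h3 hs, inner_neg_left] at h4
  have h5 : c * ‖p s‖ * ‖y s - x s‖ ^ 2 ≤ c * B * δ ^ 2 := by
    have hB := (norm_nonneg _).trans (hpB s hs)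
    gcongr
    · exact hpB s hs
    · exact hδ s hs
  rw [inner_sub_right, real_inner_comm, real_inner_comm (x' s)]
  linarith

/-- First order expansion of an arc tested against a continuous multiplier. -/
theorem ACArc.eventually_abs_inner_sub_le {a b t M : ℝ} {x x' p : ℝ → E} {h : ℝ → ℝ}
    (hx : ACArc a b x x') (hM : ∀ᵐ s, s ∈ Icc a b → ‖x' s‖ ≤ M) (ht : t ∈ Ioo a b)
    (hp : ContinuousOn p (Icc a b)) (hh : ContinuousOn h (Icc a b))
    (hxp : ∀ᵐ s, s ∈ Icc a b → ⟪x' s, p s⟫ = h s) {ε : ℝ} (hε : 0 < ε) :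
    ∀ᶠ s in 𝓝 t, |⟪p t, x s - x t⟫ - h t * (s - t)| ≤ ε * |s - t| := by
  have hnhds : Icc a b ∈ 𝓝 t := Icc_mem_nhds ht.1 ht.2
  have hlim : Tendsto (fun r => ‖p t - p r‖ * M + |h r - h t|) (𝓝 t) (𝓝 0) := by
    have h1 : ContinuousAt (fun r => ‖p t - p r‖ * M + |h r - h t|) t :=
      ((continuousAt_const.sub (hp.continuousAt hnhds)).norm.mul continuousAt_const).add
        ((hh.continuousAt hnhds).sub continuousAt_const).abs
    simpa [ContinuousAt] using h1
  obtain ⟨η, hη, hball⟩ := Metric.mem_nhds_iff.1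
    (Filter.inter_mem hnhds (hlim.eventually (gt_mem_nhds hε)))
  filter_upwards [ball_mem_nhds t hη] with s hs
  have htI : t ∈ Icc a b := Ioo_subset_Icc_self ht
  have hsI : s ∈ Icc a b := (hball hs).1
  have hI : IntervalIntegrable x' volume t s := by
    refine hx.1.mono_set ?_
    rw [uIcc_of_le (htI.1.trans htI.2)]
    exact uIcc_subset_Icc htI hsI
  have hint2 : IntervalIntegrable (fun r => ⟪p t, x' r⟫) volume t s :=
    ⟨(innerSL ℝ (p t)).integrable_comp hI.1, (innerSL ℝ (p t)).integrable_comp hI.2⟩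
  have e1 : ∫ r in t..s, ⟪p t, x' r⟫ = ⟪p t, x s - x t⟫ := by
    rw [← hx.integral_eq_sub' htI hsI]
    exact ContinuousLinearMap.intervalIntegral_comp_comm (innerSL ℝ (p t)) hI
  have e : ⟪p t, x s - x t⟫ - h t * (s - t) = ∫ r in t..s, (⟪p t, x' r⟫ - h t) := by
    rw [intervalIntegral.integral_sub hint2 intervalIntegrable_const, e1]
    simp [mul_comm]
  rw [e, ← Real.norm_eq_abs]
  refine intervalIntegral.norm_integral_le_of_norm_le_const_ae ?_
  filter_upwards [hM, hxp] with r h1 h2 hr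
  have hrb : r ∈ ball t η := by
    rw [mem_ball, Real.dist_eq] at hs ⊢
    exact (abs_sub_left_of_mem_uIcc (uIoc_subset_uIcc hr)).trans_lt hs
  obtain ⟨hrI, hrε⟩ := hball hrb
  have e2 : ⟪p t, x' r⟫ - h t = ⟪p t - p r, x' r⟫ + (h r - h t) := by
    rw [← h2 hrI, inner_sub_left, real_inner_comm (x' r) (p r)]; ring
  rw [e2, Real.norm_eq_abs]
  refine (abs_add_le _ _).trans (le_of_lt ?_)
  refine lt_of_le_of_lt ?_ hrε
  gcongr
  exact (abs_real_inner_le_norm _ _).trans (by gcongr; exact h1 hrI)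

theorem valueFn_le_of_isTraj [ProperSpace E] {F : E → Set E} {φ : E → ℝ} (hF : StandingHyp F)
    (hφ : Continuous φ) {s T : ℝ} (hs : s ≤ T) {y y' : ℝ → E} (hy : IsTraj F s T y y') :
    valueFn F φ T s (y s) ≤ φ (y T) := by
  obtain ⟨-, -, r, hr, h3⟩ := hF
  refine csInf_le ?_ ⟨y, y', hy, rfl, rfl⟩
  obtain ⟨m, hm⟩ := (isCompact_closedBall (0 : E)
    ((1 + ‖y s‖) * Real.exp (r * (T - s)))).bddBelow_image hφ.continuousOn
  refine ⟨m, ?_⟩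
  rintro _ ⟨z, z', hz, hzs, rfl⟩
  refine hm ⟨z T, ?_, rfl⟩
  have := hz.norm_le hr.le h3 hs
  rw [hzs] at this
  rw [mem_closedBall_zero_iff]
  linarith

theorem IsOptimal.le_valueFn {F : E → Set E} {φ : E → ℝ} {t0 T t : ℝ} {x0 : E} {x x' : ℝ → E}
    (hx : IsOptimal F φ t0 T x0 x x') (ht : t ∈ Icc t0 T) : φ (x T) ≤ valueFn F φ T t (x t) := by
  refine le_csInf ⟨_, x, x', hx.1.mono ht.1 ht.2 le_rfl, rfl, rfl⟩ ?_
  rintro _ ⟨y, y', hy, hyt, rfl⟩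
  have h := hx.2.2 _ _ ((hx.1.mono le_rfl ht.1 ht.2).concat ht.1 ht.2 hy hyt.symm)
    (by simpa [ht.1] using hx.2.1)
  refine h.trans_eq ?_
  rcases ht.2.eq_or_lt with rfl | hlt
  · simp [hyt]
  · simp [hlt.not_ge]

end ValueFunction

section Sensitivity

/-- From every point close to the graph of the optimal trajectory there starts a trajectory
which stays close to it and whose endpoint is controlled by the adjoint arc. -/
theorem exists_comparison_traj {n : ℕ} {F : Euc n → Set (Euc n)} {t0 T : ℝ}
    {x x' p p' : ℝ → Euc n} (hSH : StandingHyp F) (hH1 : HypH1 F) (ht : t0 < T)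
    (hx : IsTraj F t0 T x x') (hp : ACArc t0 T p p')
    (hadj : ∀ᵐ s, s ∈ Icc t0 T → -p' s ∈ FSub (fun z => Ham F z (p s)) (x s) ∧
      x' s ∈ ClarkeGrad (fun q => Ham F (x s) q) (p s)) :
    ∃ M C A : ℝ, 0 ≤ M ∧ 0 ≤ C ∧ 0 ≤ A ∧ (∀ᵐ s, s ∈ Icc t0 T → ‖x' s‖ ≤ M) ∧
      (∀ᵐ s, s ∈ Icc t0 T → ⟪x' s, p s⟫ = Ham F (x s) (p s)) ∧
      ContinuousOn (fun s => Ham F (x s) (p s)) (Icc t0 T) ∧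
      ∀ s ∈ Icc t0 T, ∀ y0, C * ‖y0 - x s‖ ≤ 1 → ∃ y y', IsTraj F s T y y' ∧ y s = y0 ∧
        ‖y T - x T‖ ≤ C * ‖y0 - x s‖ ∧
        -(A * ‖y0 - x s‖ ^ 2) ≤ ⟪p T, y T - x T⟫ - ⟪p s, y0 - x s⟫ := by
  have hxc := hx.1.continuousOn ht.le
  have hpc := hp.continuousOn ht.le
  obtain ⟨R0, hR0⟩ := (isCompact_Icc.image_of_continuousOn hxc.norm).bddAbove
  obtain ⟨B, hB⟩ := (isCompact_Icc.image_of_continuousOn hpc.norm).bddAbove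
  replace hR0 : ∀ s ∈ Icc t0 T, ‖x s‖ ≤ R0 := fun s hs => hR0 ⟨s, hs, rfl⟩
  replace hB : ∀ s ∈ Icc t0 T, ‖p s‖ ≤ B := fun s hs => hB ⟨s, hs, rfl⟩
  have hB0 : 0 ≤ B := (norm_nonneg _).trans (hB t0 ⟨le_rfl, ht.le⟩)
  have hRpos : 0 ≤ R0 := (norm_nonneg _).trans (hR0 t0 ⟨le_rfl, ht.le⟩)
  set R := R0 + 1 with hR
  have hRp : 0 ≤ R := by linarith
  have hxR : ∀ s ∈ Icc t0 T, x s ∈ closedBall (0 : Euc n) R := fun s hs => by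
    rw [mem_closedBall_zero_iff]; linarith [hR0 s hs]
  obtain ⟨P, hP, hP1, hP2⟩ := exists_retraction_closedBall (E := Euc n) hRp
  obtain ⟨L, hL, hFL⟩ := hSH.exists_lipschitz (isCompact_closedBall (0 : Euc n) R)
  obtain ⟨M, hM, hG⟩ := hSH.lipBddMap_comp hL hFL hP hP1
  obtain ⟨c, hc, hsc⟩ := hH1.1 (closedBall (0 : Euc n) R) (nonempty_closedBall.2 hRp)
    (convex_closedBall _ _) (isCompact_closedBall _ _)
  have hFM : ∀ z ∈ closedBall (0 : Euc n) R, ∀ v ∈ F z, ‖v‖ ≤ M := fun z hz v hv =>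
    hG.norm_le z v (by simpa only [hP2 z hz] using hv)
  have hx'M : ∀ᵐ s, s ∈ Icc t0 T → ‖x' s‖ ≤ M := by
    filter_upwards [hx.2] with s h hs
    exact hFM _ (hxR s hs) _ (h hs)
  have hmax : ∀ᵐ s, s ∈ Icc t0 T → ⟪x' s, p s⟫ = Ham F (x s) (p s) := by
    filter_upwards [hx.2, hadj] with s h1 h2 hs
    exact le_antisymm (inner_le_ham (hSH.1 _).2.2 (h1 hs) _)
      (ham_le_inner_of_mem_clarkeGrad (hSH.1 _).2.2 (hSH.1 _).1 (hFM _ (hxR s hs)) (h2 hs).2)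
  have hHP : ∀ z ∈ closedBall (0 : Euc n) R, ∀ q, Ham (fun w => F (P w)) z q = Ham F z q :=
    fun z hz q => by simp only [Ham, hP2 z hz]
  have hHc : ContinuousOn (fun s => Ham F (x s) (p s)) (Icc t0 T) :=
    (hG.continuous_ham.comp_continuousOn (hxc.prodMk hpc)).congr
      fun s hs => (hHP _ (hxR s hs) _).symm
  have hp'L : ∀ᵐ s, s ∈ Icc t0 T → ‖p' s‖ ≤ L * ‖p s‖ := by
    filter_upwards [hadj] with s h hs
    rw [← norm_neg]
    refine norm_le_of_mem_fSub (by positivity) ?_ (h hs).1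
    have hnear : closedBall (0 : Euc n) R ∈ 𝓝 (x s) := by
      refine mem_of_superset (ball_mem_nhds (x s) one_pos) fun z hz => ?_
      rw [mem_ball, dist_eq_norm] at hz
      rw [mem_closedBall_zero_iff]
      have := norm_add_le (z - x s) (x s)
      rw [sub_add_cancel] at this
      linarith [hR0 s hs]
    filter_upwards [hnear] with z hz
    have := ham_sub_le (hSH.1 z).2.2 (hSH.1 z).1 (hSH.1 (x s)).2.2
      (fun v hv => hFL z hz (x s) (hxR s hs) v hv) (hFM _ (hxR s hs)) (p s) (p s)
    rw [sub_self, norm_zero, mul_zero, zero_add] at this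
    linarith
  set q : ℝ → Euc n := fun s => p (projIcc t0 T ht.le s) with hq
  have hqp : ∀ s ∈ Icc t0 T, q s = p s := fun s hs => by simp [hq, projIcc_of_mem ht.le hs]
  have hqc : Continuous q :=
    (continuousOn_iff_continuous_domRestrict.1 hpc).comp (continuous_projIcc (h := ht.le))
  have hqQ : ∀ s, q s ∈ p '' Icc t0 T := fun s => ⟨_, (projIcc t0 T ht.le s).2, rfl⟩
  have h0 : (0 : Euc n) ∉ p '' Icc t0 T ∨ ∀ s, q s = 0 := by
    by_cases h : (0 : Euc n) ∈ p '' Icc t0 T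
    · obtain ⟨r, hr, hr0⟩ := h
      exact Or.inr fun s => hp.eq_zero hL hp'L hr hr0 _ (projIcc t0 T ht.le s).2
    · exact Or.inl h
  obtain ⟨S, hSc, hSm, L', hL', hSL⟩ := exists_maxFace_selection hH1 hP hP1 hG hqc
    (isCompact_Icc.image_of_continuousOn hpc) hqQ h0
  set C := 1 + L' * Real.exp (L' * (T - t0)) * (T - t0) with hC
  have hTt : 0 ≤ T - t0 := by linarith
  have hC0 : 0 ≤ C := by positivity
  refine ⟨M, C, c * B * C ^ 2 * (T - t0), hM, hC0, by positivity, hx'M, hmax, hHc, ?_⟩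
  intro s hs y0 hy0
  have hxs := hx.mono hs.1 hs.2 le_rfl
  have hsub : ∀ r ∈ Icc s T, r ∈ Icc t0 T := fun r hr => ⟨hs.1.trans hr.1, hr.2⟩
  obtain ⟨y, y', hy, hys, hyΓ, hyC⟩ := exists_traj_near hSc
    (Γ := fun s z => maxFace (fun w => F (P w)) (q s) z)
    (fun r => hG.isClosed_maxFace_graph.preimage
      (f := fun w : Euc n × Euc n => ((q r, w.1), w.2)) (by fun_prop))
    hSm hL' hs.2 hSL hxs.1.1 hxs.1.2.1
    (by
      filter_upwards [hx.2, hmax] with r h1 h2 hr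
      have hr' := hsub r hr
      refine ⟨?_, ?_⟩
      · simpa only [hP2 _ (hxR r hr')] using h1 hr'
      · rw [hqp r hr', hHP _ (hxR r hr'), h2 hr']) y0
  have hyδ : ∀ r ∈ Icc s T, ‖y r - x r‖ ≤ C * ‖y0 - x s‖ := fun r hr => by
    refine (hyC r hr).trans ?_
    have h1 : T - s ≤ T - t0 := by linarith [hs.1]
    have h2 : 0 ≤ T - s := by linarith [hs.2]
    rw [hC]
    gcongr
  have hyR : ∀ r ∈ Icc s T, y r ∈ closedBall (0 : Euc n) R := fun r hr => by
    rw [mem_closedBall_zero_iff]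
    have := norm_add_le (y r - x r) (x r)
    rw [sub_add_cancel] at this
    linarith [hR0 r (hsub r hr), hyδ r hr]
  have hyF : ∀ᵐ r, r ∈ Icc s T → y' r ∈ F (y r) ∧ ⟪y' r, p r⟫ = Ham F (y r) (p r) := by
    filter_upwards [hyΓ] with r h hr
    obtain ⟨h1, h2⟩ := h hr
    rw [hqp r (hsub r hr), hHP _ (hyR r hr)] at h2
    exact ⟨by simpa only [hP2 _ (hyR r hr)] using h1, h2⟩
  refine ⟨y, y', ⟨hy, hyF.mono fun r h hr => (h hr).1⟩, hys, hyδ T ⟨hs.2, le_rfl⟩, ?_⟩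
  have key := inner_adjoint_sub_ge hs.2 hc (convex_closedBall (0 : Euc n) R) hsc hxs.1 hy
    (hp.mono hs.1 hs.2 le_rfl) (fun r hr => hxR r (hsub r hr)) hyR
    (fun r hr => hB r (hsub r hr)) hyδ (hadj.mono fun r h hr => (h (hsub r hr)).1)
    (hmax.mono fun r h hr => h (hsub r hr)) (hyF.mono fun r h hr => (h hr).2)
  rw [hys] at key
  refine le_trans ?_ key
  have h1 : c * B * (C * ‖y0 - x s‖) ^ 2 * (T - s) ≤ c * B * (C * ‖y0 - x s‖) ^ 2 * (T - t0) := by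
    have : T - s ≤ T - t0 := by linarith [hs.1]
    gcongr
  have h2 : c * B * (C * ‖y0 - x s‖) ^ 2 * (T - t0)
      = c * B * C ^ 2 * (T - t0) * ‖y0 - x s‖ ^ 2 := by ring
  linarith

end Sensitivity

/-- Theorem 3.5, full sensitivity relation.
Under (SH), (H1), with `φ` locally Lipschitz, if `x̄` is optimal for `P(t₀,x₀)` and `p̄`
solves the Hamiltonian adjoint inclusion with Fréchet transversality condition
`−p̄(T) ∈ ∂⁺φ(x̄(T))`, then `(H(x̄(t),p̄(t)), −p̄(t)) ∈ ∂⁺V(t,x̄(t))` for all `t ∈ (t₀,T)`. -/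
theorem stmt1 {n : ℕ} (F : Euc n → Set (Euc n)) (φ : Euc n → ℝ)
    (t0 T : ℝ) (x0 : Euc n) (xbar xbar' pbar pbar' : ℝ → Euc n)
    (hSH : StandingHyp F) (hH1 : HypH1 F) (hφ : LocallyLipschitz φ) (ht : t0 < T)
    (hopt : IsOptimal F φ t0 T x0 xbar xbar')
    (hpAC : ACArc t0 T pbar pbar')
    (hadj : ∀ᵐ t ∂volume, t ∈ Icc t0 T →
      -pbar' t ∈ FSub (fun y => Ham F y (pbar t)) (xbar t) ∧
      xbar' t ∈ ClarkeGrad (fun q => Ham F (xbar t) q) (pbar t))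
    (htrans : -pbar T ∈ FSuper φ (xbar T)) :
    ∀ t ∈ Ioo t0 T,
      (Ham F (xbar t) (pbar t), -pbar t) ∈ FSuperPair (valueFn F φ T) t (xbar t) := by
  obtain ⟨M, C, A, hM, hC, hA, hxM, hmax, hHc, hcomp⟩ :=
    exists_comparison_traj hSH hH1 ht hopt.1 hpAC hadj
  intro t htI ε hε
  have htI' : t ∈ Icc t0 T := Ioo_subset_Icc_self htI
  have hpc := hpAC.continuousOn ht.le
  set D := 1 + M with hD
  have hD0 : 0 ≤ D := by positivity
  set ε₁ := ε / (4 * (C * D + 1)) with hε₁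
  have hε₁0 : 0 < ε₁ := by positivity
  obtain ⟨ρ, hρ, hball⟩ := Metric.eventually_nhds_iff.1 (htrans ε₁ hε₁0)
  have hN : Tendsto (fun sy : ℝ × Euc n => ‖((sy.1 - t, sy.2 - xbar t) : ℝ × Euc n)‖)
      (𝓝 (t, xbar t)) (𝓝 0) := by
    apply Continuous.tendsto' (by fun_prop)
    simp
  have hsmall : ∀ k b : ℝ, 0 < b → ∀ᶠ sy : ℝ × Euc n in 𝓝 (t, xbar t),
      k * ‖((sy.1 - t, sy.2 - xbar t) : ℝ × Euc n)‖ < b := fun k b hb => by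
    have := hN.const_mul k
    rw [mul_zero] at this
    exact this.eventually (gt_mem_nhds hb)
  have hfst : Tendsto (fun sy : ℝ × Euc n => sy.1) (𝓝 (t, xbar t)) (𝓝 t) :=
    continuous_fst.tendsto _
  have hpt : ∀ᶠ s in 𝓝 t, ‖pbar t - pbar s‖ * D < ε / 4 := by
    have h1 : ContinuousAt (fun s => ‖pbar t - pbar s‖ * D) t :=
      (continuousAt_const.sub
        (hpc.continuousAt (Icc_mem_nhds htI.1 htI.2))).norm.mul continuousAt_const
    have h2 : Tendsto (fun s => ‖pbar t - pbar s‖ * D) (𝓝 t) (𝓝 0) := by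
      simpa [ContinuousAt] using h1
    exact h2.eventually (gt_mem_nhds (by positivity))
  filter_upwards [hsmall (C * D) 1 one_pos, hsmall (C * D) ρ hρ,
    hsmall (A * D ^ 2) (ε / 4) (by positivity), hfst.eventually hpt,
    hfst.eventually (hopt.1.1.eventually_abs_inner_sub_le hxM htI hpc hHc hmax
      (ε := ε / 4) (by positivity)),
    hfst.eventually (Icc_mem_nhds htI.1 htI.2)]
  rintro ⟨s, y0⟩ h1 h2 h3 h4 h5 hs
  replace hs : s ∈ Icc t0 T := hs
  simp only at h1 h2 h3 h4 h5 ⊢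
  set N := ‖((s - t, y0 - xbar t) : ℝ × Euc n)‖ with hNdef
  have hN0 : 0 ≤ N := norm_nonneg _
  have hsN : |s - t| ≤ N := norm_fst_le ((s - t, y0 - xbar t) : ℝ × Euc n)
  have hyN : ‖y0 - xbar t‖ ≤ N := norm_snd_le ((s - t, y0 - xbar t) : ℝ × Euc n)
  set δ := ‖y0 - xbar s‖ with hδ
  have hδN : δ ≤ D * N := by
    have e : y0 - xbar s = (y0 - xbar t) - (xbar s - xbar t) := by abel
    have h6 := hopt.1.1.norm_sub_le hxM htI' hs
    have h7 : M * |s - t| ≤ M * N := by gcongr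
    rw [hδ, e]
    refine (norm_sub_le _ _).trans ?_
    rw [hD, add_mul, one_mul]
    linarith
  have hCδ : C * δ ≤ C * D * N := by
    rw [mul_assoc]
    gcongr
  obtain ⟨y, y', hy, hys, hyT, hkey⟩ := hcomp s hs y0 (hCδ.trans h1.le)
  have hV1 := valueFn_le_of_isTraj hSH hφ.continuous hs.2 hy
  rw [hys] at hV1
  have hV2 := hopt.le_valueFn htI'
  have hφT := hball (y := y T) (by
    rw [dist_eq_norm]
    exact (hyT.trans hCδ).trans_lt h2)
  rw [inner_neg_left] at hφT
  have b1 : ε₁ * ‖y T - xbar T‖ ≤ ε / 4 * N := by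
    calc ε₁ * ‖y T - xbar T‖ ≤ ε₁ * (C * D * N) := by gcongr; exact hyT.trans hCδ
      _ ≤ ε₁ * ((C * D + 1) * N) := by gcongr; linarith
      _ = ε / 4 * N := by rw [hε₁]; field_simp
  have b2 : A * δ ^ 2 ≤ ε / 4 * N := by
    calc A * δ ^ 2 ≤ A * (D * N) ^ 2 := by gcongr
      _ = A * D ^ 2 * N * N := by ring
      _ ≤ ε / 4 * N := by gcongr
  have b3 : ⟪pbar t - pbar s, y0 - xbar s⟫ ≤ ε / 4 * N := by
    calc ⟪pbar t - pbar s, y0 - xbar s⟫ ≤ ‖pbar t - pbar s‖ * δ := real_inner_le_norm _ _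
      _ ≤ ‖pbar t - pbar s‖ * (D * N) := by gcongr
      _ = ‖pbar t - pbar s‖ * D * N := by ring
      _ ≤ ε / 4 * N := by gcongr
  have b4 : ⟪pbar t, xbar s - xbar t⟫ - Ham F (xbar t) (pbar t) * (s - t) ≤ ε / 4 * N :=
    (le_abs_self _).trans (h5.trans (by gcongr))
  have e1 : ⟪pbar s, y0 - xbar s⟫ = ⟪pbar t, y0 - xbar t⟫ - ⟪pbar t, xbar s - xbar t⟫
      - ⟪pbar t - pbar s, y0 - xbar s⟫ := by
    simp only [inner_sub_left, inner_sub_right]; ring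
  rw [inner_neg_left]
  linarith

end
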